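/- arXiv:1509.01813 — 2 statements merged into one kernel-verified Lean document; each statement's English description precedes it below -/
import Mathlib

section
/- Let K be a field of characteristic zero and R = K[x_1,...,x_n]. If f ∈ R is a nonzero product of pairwise non-proportional linear (degree one) polynomials defining a hyperplane arrangement A in K^n, then the length of the first local cohomology module H^1_{(f)}(R) = R[f^{-1}]/R as a left module over the Weyl algebra D_n equals its multiplicity (with respect to the Bernstein filtration). -/
open Polynomial MvPolynomial

/-- Defining relations of the `n`-th Weyl algebra over `K`:
generators `Sum.inl i` are the multiplication operators `x_i`, generators
`Sum.inr i` are the partial derivations `∂_i`. -/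
inductive WeylRel (K : Type) [Field K] (n : ℕ) :
    FreeAlgebra K (Fin n ⊕ Fin n) → FreeAlgebra K (Fin n ⊕ Fin n) → Prop
  | xx (i j : Fin n) : WeylRel K n
      (FreeAlgebra.ι K (Sum.inl i) * FreeAlgebra.ι K (Sum.inl j))
      (FreeAlgebra.ι K (Sum.inl j) * FreeAlgebra.ι K (Sum.inl i))
  | dd (i j : Fin n) : WeylRel K n
      (FreeAlgebra.ι K (Sum.inr i) * FreeAlgebra.ι K (Sum.inr j))
      (FreeAlgebra.ι K (Sum.inr j) * FreeAlgebra.ι K (Sum.inr i))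
  | dx (i j : Fin n) : WeylRel K n
      (FreeAlgebra.ι K (Sum.inr i) * FreeAlgebra.ι K (Sum.inl j))
      (FreeAlgebra.ι K (Sum.inl j) * FreeAlgebra.ι K (Sum.inr i)
        + if i = j then 1 else 0)

/-- The `n`-th Weyl algebra `D_n` over `K`. -/
abbrev Weyl (K : Type) [Field K] (n : ℕ) : Type := RingQuot (WeylRel K n)

/-- The operator `x_i ∈ D_n`. -/
noncomputable def wX (K : Type) [Field K] (n : ℕ) (i : Fin n) : Weyl K n :=
  RingQuot.mkAlgHom K (WeylRel K n) (FreeAlgebra.ι K (Sum.inl i))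

/-- The operator `∂_i ∈ D_n`. -/
noncomputable def wD (K : Type) [Field K] (n : ℕ) (i : Fin n) : Weyl K n :=
  RingQuot.mkAlgHom K (WeylRel K n) (FreeAlgebra.ι K (Sum.inr i))

/-- The Bernstein filtration on the Weyl algebra: `F_k(D_n)` is spanned by the
monomials `x^α ∂^β` with `|α| + |β| ≤ k`. -/
noncomputable def bernsteinF (K : Type) [Field K] (n : ℕ) (k : ℤ) :
    Submodule K (Weyl K n) :=
  Submodule.span K {w | ∃ α β : Fin n → ℕ,
    ((∑ i, α i : ℕ) + (∑ i, β i : ℕ) : ℤ) ≤ k ∧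
    w = ((List.finRange n).map fun i => wX K n i ^ α i).prod *
        ((List.finRange n).map fun i => wD K n i ^ β i).prod}

/-- A good Bernstein filtration on a left `D_n`-module `M`. -/
structure GoodFiltration (K : Type) [Field K] (n : ℕ) (M : Type)
    [AddCommGroup M] [Module K M] [Module (Weyl K n) M]
    [IsScalarTower K (Weyl K n) M] (F : ℤ → Submodule K M) : Prop where
  mono : ∀ k, F k ≤ F (k + 1)
  exhaustive : ∀ m : M, ∃ k, m ∈ F k
  compat : ∀ j k : ℤ, ∀ w ∈ bernsteinF K n j, ∀ m ∈ F k, w • m ∈ F (j + k)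
  bddBelow : ∃ k₀ : ℤ, ∀ k < k₀, F k = ⊥
  finiteDim : ∀ k, FiniteDimensional K (F k)
  good : ∃ k₁ : ℤ, ∀ k ≥ k₁, ∀ j ≥ (0 : ℤ),
    F (j + k) ≤ Submodule.span K
      {m | ∃ w ∈ bernsteinF K n j, ∃ v ∈ F k, m = w • v}

/-- `HasMult K n M m` : the holonomic module `M` admits a good Bernstein filtration
whose Hilbert polynomial `h` satisfies `(deg h)! · (leading coeff of h) = m`; i.e.
the multiplicity of `M` is `m`. -/
def HasMult (K : Type) [Field K] (n : ℕ) (M : Type)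
    [AddCommGroup M] [Module K M] [Module (Weyl K n) M]
    [IsScalarTower K (Weyl K n) M] (m : ℚ) : Prop :=
  ∃ F : ℤ → Submodule K M, GoodFiltration K n M F ∧
    ∃ h : Polynomial ℚ,
      (∃ N : ℤ, ∀ k ≥ N, (Module.finrank K (F k) : ℚ) = h.eval (k : ℚ)) ∧
      m = (Nat.factorial h.natDegree : ℚ) * h.leadingCoeff

/-- `M` is a holonomic left `D_n`-module. -/
def IsHolonomic (K : Type) [Field K] (n : ℕ) (M : Type)
    [AddCommGroup M] [Module K M] [Module (Weyl K n) M]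
    [IsScalarTower K (Weyl K n) M] : Prop :=
  Subsingleton M ∨
  ∃ F : ℤ → Submodule K M, GoodFiltration K n M F ∧
    ∃ h : Polynomial ℚ,
      (∃ N : ℤ, ∀ k ≥ N, (Module.finrank K (F k) : ℚ) = h.eval (k : ℚ)) ∧
      h.natDegree = n

/-- The length of a module: the Krull dimension of its lattice of submodules. -/
noncomputable def mlength (A : Type) [Ring A] (M : Type) [AddCommGroup M]
    [Module A M] : WithBot ℕ∞ :=
  Order.krullDim (Submodule A M)

section LocalCoh
variable (K : Type) [Field K] (n : ℕ)

/-- The zero set in `K^n` of a polynomial. -/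
def zeroSet (p : MvPolynomial (Fin n) K) : Set (Fin n → K) :=
  {x | MvPolynomial.eval x p = 0}

/-- The property that a given `D_n`-module structure on the localization
`R[f⁻¹]` is the natural one: `x_i` acts by multiplication and `∂_i` acts as the
(unique) derivation of `R[f⁻¹]` extending `∂/∂x_i` on `R`. -/
def NatActs (f : MvPolynomial (Fin n) K)
    [Module (Weyl K n) (Localization.Away f)] : Prop :=
  (∀ (i : Fin n) (m : Localization.Away f),
      wX K n i • m =
        algebraMap (MvPolynomial (Fin n) K) (Localization.Away f)
          (MvPolynomial.X i) * m) ∧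
  (∀ i : Fin n, ∃ δ : Derivation K (Localization.Away f) (Localization.Away f),
      (∀ m, wD K n i • m = δ m) ∧
      ∀ r : MvPolynomial (Fin n) K,
        δ (algebraMap (MvPolynomial (Fin n) K) (Localization.Away f) r) =
          algebraMap (MvPolynomial (Fin n) K) (Localization.Away f)
            (MvPolynomial.pderiv i r))

/-- The first local cohomology module `H¹_{(f)}(R) = R[f⁻¹]/R` as a left
`D_n`-module. -/
noncomputable abbrev H1 (f : MvPolynomial (Fin n) K)
    [Module (Weyl K n) (Localization.Away f)] : Type :=
  (Localization.Away f) ⧸ Submodule.span (Weyl K n)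
    (Set.range (algebraMap (MvPolynomial (Fin n) K) (Localization.Away f)))

end LocalCoh

section Arrangement
open scoped Classical
variable (K : Type) [Field K] (n : ℕ)

/-- The intersection poset of an arrangement `𝒜` of hyperplanes inside the
ambient affine subspace `V0`: all nonempty intersections of subfamilies
(including the ambient space `V0` itself, as the empty intersection). -/
noncomputable def interPoset (V0 : Set (Fin n → K))
    (𝒜 : Finset (Set (Fin n → K))) : Finset (Set (Fin n → K)) :=
  (𝒜.powerset.image fun S => V0 ∩ ⋂ H ∈ S, H).filter fun X => X ≠ ∅

/-- Codimension of `X` inside the ambient affine subspace `V0`. -/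
noncomputable def codim (V0 X : Set (Fin n → K)) : ℕ :=
  Module.finrank K (vectorSpan K V0) - Module.finrank K (vectorSpan K X)

/-- `μ` is the Möbius function of the intersection poset of `𝒜` (with ambient
space `V0`), for the order `X ≤ Y ↔ X ⊇ Y`. -/
def IsMobius (V0 : Set (Fin n → K)) (𝒜 : Finset (Set (Fin n → K)))
    (μ : Set (Fin n → K) → ℤ) : Prop :=
  μ V0 = 1 ∧
  ∀ Y ∈ interPoset K n V0 𝒜, Y ≠ V0 →
    ∑ Z ∈ (interPoset K n V0 𝒜).filter fun Z => Y ⊆ Z, μ Z = 0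

/-- The Poincaré polynomial `π(𝒜,t) = ∑_{X ∈ L(𝒜)} μ(X)(−t)^{codim X}`. -/
noncomputable def poin (V0 : Set (Fin n → K)) (𝒜 : Finset (Set (Fin n → K)))
    (μ : Set (Fin n → K) → ℤ) : Polynomial ℤ :=
  ∑ X ∈ interPoset K n V0 𝒜, Polynomial.C (μ X) * (- Polynomial.X) ^ codim K n V0 X

end Arrangement


section WeylSystems

variable {K : Type} [Field K] {n : ℕ}

lemma wX_comm (i j : Fin n) : wX K n i * wX K n j = wX K n j * wX K n i := by
  simpa only [wX, map_mul] using RingQuot.mkAlgHom_rel K (WeylRel.xx (K := K) i j)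

lemma wD_comm (i j : Fin n) : wD K n i * wD K n j = wD K n j * wD K n i := by
  simpa only [wD, map_mul] using RingQuot.mkAlgHom_rel K (WeylRel.dd (K := K) i j)

lemma wD_mul_wX (i j : Fin n) :
    wD K n i * wX K n j = wX K n j * wD K n i + if i = j then 1 else 0 := by
  have h := RingQuot.mkAlgHom_rel K (WeylRel.dx (K := K) i j)
  split_ifs at h ⊢ <;> simpa only [wX, wD, map_mul, map_add, map_one, map_zero] using h

lemma adjoin_wX_wD :
    Algebra.adjoin K (Set.range (wX K n) ∪ Set.range (wD K n)) = ⊤ := by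
  have h : (⊤ : Subalgebra K (Weyl K n)) =
      (⊤ : Subalgebra K (FreeAlgebra K (Fin n ⊕ Fin n))).map
        (RingQuot.mkAlgHom K (WeylRel K n)) := by
    rw [Algebra.map_top]
    exact ((AlgHom.range_eq_top _).2 (RingQuot.mkAlgHom_surjective K _)).symm
  rw [h, ← FreeAlgebra.adjoin_range_ι, AlgHom.map_adjoin, ← Set.range_comp]
  congr 1
  ext w
  simp only [Set.mem_union, Set.mem_range, Function.comp_apply, Sum.exists]
  rfl

/-- The degree-one part of the Bernstein filtration: the span of `1`, the `x_i` and the `∂_i`. -/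
noncomputable def weylLinear (K : Type) [Field K] (n : ℕ) : Submodule K (Weyl K n) :=
  Submodule.span K ({1} ∪ (Set.range (wX K n) ∪ Set.range (wD K n)))

lemma one_mem_weylLinear : (1 : Weyl K n) ∈ weylLinear K n :=
  Submodule.subset_span (Or.inl rfl)

lemma wX_mem_weylLinear (i : Fin n) : wX K n i ∈ weylLinear K n :=
  Submodule.subset_span (Or.inr (Or.inl ⟨i, rfl⟩))

lemma wD_mem_weylLinear (i : Fin n) : wD K n i ∈ weylLinear K n :=
  Submodule.subset_span (Or.inr (Or.inr ⟨i, rfl⟩))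

/-- Canonical generators of the Weyl algebra: `b_i` commute with each other, `[a_i, b_j] = δ_ij`,
and the `a_i`, `b_i` together with `1` span the same space as `1`, `x_i`, `∂_i`. -/
structure WeylSystem (K : Type) [Field K] (n : ℕ) where
  /-- the annihilation operators -/
  a : Fin n → Weyl K n
  /-- the creation operators -/
  b : Fin n → Weyl K n
  comm : ∀ i j, b i * b j = b j * b i
  rel : ∀ i j, a i * b j = b j * a i + if i = j then 1 else 0
  a_mem : ∀ i, a i ∈ weylLinear K n
  b_mem : ∀ i, b i ∈ weylLinear K n
  le_span : weylLinear K n ≤ Submodule.span K ({1} ∪ (Set.range a ∪ Set.range b))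

namespace WeylSystem

/-- Evaluation of a polynomial at the commuting operators `b_i`. -/
noncomputable def ev (s : WeylSystem K n) : MvPolynomial (Fin n) K →ₐ[K] Weyl K n :=
  letI : CommRing (Algebra.adjoin K (Set.range s.b)) :=
    { (inferInstance : Ring (Algebra.adjoin K (Set.range s.b))) with
      mul_comm := (Algebra.isMulCommutative_adjoin K (s := Set.range s.b) (by
        rintro _ ⟨i, rfl⟩ _ ⟨j, rfl⟩
        exact s.comm i j)).is_comm.comm }
  (Algebra.adjoin K (Set.range s.b)).val.comp
    (MvPolynomial.aeval fun i => ⟨s.b i, Algebra.subset_adjoin ⟨i, rfl⟩⟩)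

@[simp]
lemma ev_X (s : WeylSystem K n) (i : Fin n) : s.ev (MvPolynomial.X i) = s.b i := by
  simp [ev]

lemma a_mul_ev (s : WeylSystem K n) (i : Fin n) (p : MvPolynomial (Fin n) K) :
    s.a i * s.ev p = s.ev p * s.a i + s.ev (MvPolynomial.pderiv i p) := by
  induction p using MvPolynomial.induction_on with
  | C c =>
    have h : s.ev (MvPolynomial.C c) = algebraMap K _ c := s.ev.commutes c
    rw [h, MvPolynomial.pderiv_C, map_zero, add_zero, Algebra.commutes]
  | add p q hp hq =>
    simp only [map_add, mul_add, add_mul, hp, hq]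
    abel
  | mul_X p j hp =>
    rw [map_mul, ev_X, ← mul_assoc, hp, MvPolynomial.pderiv_mul, MvPolynomial.pderiv_X, add_mul,
      mul_assoc, s.rel, map_add, map_mul, map_mul, ev_X]
    by_cases h : i = j
    · subst h
      simp [mul_add, mul_assoc]
      abel
    · simp [h, Ne.symm h, mul_assoc]

end WeylSystem

variable {M : Type} [AddCommGroup M] [Module K M] [Module (Weyl K n) M]
  [IsScalarTower K (Weyl K n) M]

/-- A `K`-subspace stable under `x_i` and `∂_i` is a `D_n`-submodule. -/
lemma weyl_smul_mem {P : Submodule K M} (h : ∀ w ∈ weylLinear K n, ∀ m ∈ P, w • m ∈ P)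
    (w : Weyl K n) : ∀ m ∈ P, w • m ∈ P := by
  have hw : w ∈ Algebra.adjoin K (Set.range (wX K n) ∪ Set.range (wD K n)) := by
    rw [adjoin_wX_wD]; trivial
  induction hw using Algebra.adjoin_induction with
  | mem x hx => exact h x (Submodule.subset_span (Or.inr hx))
  | algebraMap r => intro m hm; rw [algebraMap_smul]; exact P.smul_mem r hm
  | add x y _ _ hx hy => intro m hm; rw [add_smul]; exact P.add_mem (hx m hm) (hy m hm)
  | mul x y _ _ hx hy => intro m hm; rw [mul_smul]; exact hx _ (hy m hm)

/-- An increasing family of subspaces on which `x_i` and `∂_i` have degree at most one. -/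
def IsLinearFiltration (K : Type) [Field K] (n : ℕ) {M : Type} [AddCommGroup M] [Module K M]
    [Module (Weyl K n) M] (G : ℕ → Submodule K M) : Prop :=
  ∀ w ∈ weylLinear K n, ∀ k, ∀ m ∈ G k, w • m ∈ G (k + 1)

namespace IsLinearFiltration

omit [IsScalarTower K (Weyl K n) M] in
lemma mono {G : ℕ → Submodule K M} (h : IsLinearFiltration K n G) : Monotone G :=
  monotone_nat_of_le_succ fun k m hm => by
    simpa using h 1 one_mem_weylLinear k m hm

lemma of_system (s : WeylSystem K n) {G : ℕ → Submodule K M}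
    (h1 : Monotone G) (ha : ∀ i k, ∀ m ∈ G k, s.a i • m ∈ G (k + 1))
    (hb : ∀ i k, ∀ m ∈ G k, s.b i • m ∈ G (k + 1)) : IsLinearFiltration K n G := by
  intro w hw k m hm
  replace hw := s.le_span hw
  induction hw using Submodule.span_induction with
  | mem x hx =>
    rcases hx with rfl | ⟨i, rfl⟩ | ⟨i, rfl⟩
    · rw [one_smul]; exact h1 k.le_succ hm
    · exact ha i k m hm
    · exact hb i k m hm
  | zero => rw [zero_smul]; exact zero_mem _
  | add x y _ _ hx hy => rw [add_smul]; exact add_mem hx hy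
  | smul c x _ hx => rw [smul_assoc]; exact Submodule.smul_mem _ c hx

lemma ev_smul_mem {G : ℕ → Submodule K M} (h : IsLinearFiltration K n G) (s : WeylSystem K n)
    {c k : ℕ} {p : MvPolynomial (Fin n) K} (hp : p ∈ MvPolynomial.restrictTotalDegree (Fin n) K k)
    {m : M} (hm : m ∈ G c) : s.ev p • m ∈ G (c + k) := by
  have hmon : ∀ (d : ℕ) (e : Fin n →₀ ℕ), e.degree = d →
      s.ev (MvPolynomial.monomial e 1) • m ∈ G (c + d) := by
    intro d
    induction d with
    | zero =>
      intro e he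
      rw [Finsupp.degree_eq_zero_iff] at he
      subst he
      simpa using hm
    | succ d ih =>
      intro e he
      obtain ⟨i, hi⟩ : ∃ i, e i ≠ 0 := by
        by_contra! h0
        have : e = 0 := Finsupp.ext h0
        simp [this] at he
      have hle : Finsupp.single i 1 ≤ e := by
        rw [Finsupp.single_le_iff]; omega
      obtain ⟨e', rfl⟩ := exists_add_of_le hle
      rw [map_add, Finsupp.degree_single] at he
      have he' : MvPolynomial.monomial (Finsupp.single i 1 + e') (1 : K) =
          MvPolynomial.X i * MvPolynomial.monomial e' 1 := by
        rw [MvPolynomial.X, MvPolynomial.monomial_mul, one_mul]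
      rw [he', map_mul, WeylSystem.ev_X, mul_smul]
      exact h _ (s.b_mem i) _ _ (ih e' (by omega))
  rw [MvPolynomial.restrictTotalDegree, MvPolynomial.restrictSupport_eq_span] at hp
  induction hp using Submodule.span_induction with
  | mem x hx =>
    obtain ⟨e, he, rfl⟩ := hx
    exact h.mono (Nat.add_le_add_left he c) (hmon _ e rfl)
  | zero => simp
  | add x y _ _ hx hy => rw [map_add, add_smul]; exact add_mem hx hy
  | smul r x _ hx => rw [map_smul, smul_assoc]; exact Submodule.smul_mem _ r hx

end IsLinearFiltration

end WeylSystems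

section WeylFlags

variable {K : Type} [Field K] {n : ℕ}

lemma pderiv_mem_restrictTotalDegree {p : MvPolynomial (Fin n) K} {k : ℕ}
    (hp : p ∈ MvPolynomial.restrictTotalDegree (Fin n) K (k + 1)) (i : Fin n) :
    MvPolynomial.pderiv i p ∈ MvPolynomial.restrictTotalDegree (Fin n) K k := by
  intro e he
  have h1 : MvPolynomial.coeff (e + Finsupp.single i 1) p ≠ 0 := by
    intro h0
    have he' := MvPolynomial.mem_support_iff.1 he
    refine he' ?_
    change MvPolynomial.coeff e (MvPolynomial.pderiv i p) = 0
    rw [MvPolynomial.coeff_pderiv, h0, zero_mul]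
  have h2 : (e + Finsupp.single i 1).degree ≤ k + 1 := hp (MvPolynomial.mem_support_iff.2 h1)
  rw [map_add, Finsupp.degree_single] at h2
  exact Nat.le_of_succ_le_succ h2

lemma restrictTotalDegree_mono :
    Monotone (MvPolynomial.restrictTotalDegree (Fin n) K) := fun _ _ h =>
  MvPolynomial.restrictSupport_mono K fun _ he => le_trans he h

lemma X_mul_mem_restrictTotalDegree {p : MvPolynomial (Fin n) K} {k : ℕ}
    (hp : p ∈ MvPolynomial.restrictTotalDegree (Fin n) K k) (i : Fin n) :
    MvPolynomial.X i * p ∈ MvPolynomial.restrictTotalDegree (Fin n) K (k + 1) := by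
  rw [MvPolynomial.mem_restrictTotalDegree] at hp ⊢
  refine (MvPolynomial.totalDegree_mul _ _).trans ?_
  rw [MvPolynomial.totalDegree_X]
  omega

lemma exists_pderiv_ne_zero [CharZero K] {p : MvPolynomial (Fin n) K}
    (hp : p.totalDegree ≠ 0) : ∃ i, MvPolynomial.pderiv i p ≠ 0 := by
  by_contra! h
  apply hp
  rw [MvPolynomial.totalDegree_eq_zero_iff]
  intro e he i
  by_contra hi
  have hle : Finsupp.single i 1 ≤ e := by
    rw [Finsupp.single_le_iff]; omega
  obtain ⟨e', rfl⟩ := exists_add_of_le hle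
  have h1 := congrArg (MvPolynomial.coeff e') (h i)
  rw [MvPolynomial.coeff_pderiv, MvPolynomial.coeff_zero, add_comm e'] at h1
  rcases mul_eq_zero.1 h1 with h2 | h2
  · exact MvPolynomial.mem_support_iff.1 he h2
  · exact Nat.cast_add_one_ne_zero _ h2

variable {M : Type} [AddCommGroup M] [Module K M] [Module (Weyl K n) M]
  [IsScalarTower K (Weyl K n) M]

namespace WeylSystem

/-- The map `p ↦ p(b) • v`. -/
noncomputable def evMap (s : WeylSystem K n) (v : M) : MvPolynomial (Fin n) K →ₗ[K] M :=
  ((LinearMap.toSpanSingleton (Weyl K n) M v).restrictScalars K).comp s.ev.toLinearMap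

@[simp]
lemma evMap_apply (s : WeylSystem K n) (v : M) (p : MvPolynomial (Fin n) K) :
    s.evMap v p = s.ev p • v := rfl

omit [Module K M] [IsScalarTower K (Weyl K n) M] in
lemma mem_of_ev_smul_mem [CharZero K] (s : WeylSystem K n) {P : Submodule (Weyl K n) M} {v : M}
    (hv : ∀ i, s.a i • v ∈ P) {p : MvPolynomial (Fin n) K} (hp0 : p ≠ 0)
    (hp : s.ev p • v ∈ P) : v ∈ P := by
  obtain ⟨k, hk⟩ : ∃ k, p ∈ MvPolynomial.restrictTotalDegree (Fin n) K k :=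
    ⟨_, (MvPolynomial.mem_restrictTotalDegree _ _ _).2 le_rfl⟩
  induction k generalizing p with
  | zero =>
    rw [MvPolynomial.mem_restrictTotalDegree, Nat.le_zero,
      MvPolynomial.totalDegree_eq_zero_iff_eq_C] at hk
    set c := MvPolynomial.coeff 0 p
    have hc : c ≠ 0 := by
      rintro h
      rw [h, map_zero] at hk
      exact hp0 hk
    have h1 : s.ev p = algebraMap K _ c := by
      rw [hk]; exact s.ev.commutes c
    have h2 := P.smul_mem (algebraMap K (Weyl K n) c⁻¹) hp
    rwa [h1, smul_smul, ← map_mul, inv_mul_cancel₀ hc, map_one, one_smul] at h2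
  | succ k ih =>
    by_cases h0 : p.totalDegree = 0
    · exact ih hp0 hp ((MvPolynomial.mem_restrictTotalDegree _ _ _).2 (by omega))
    · obtain ⟨i, hi⟩ := exists_pderiv_ne_zero h0
      refine ih hi ?_ (pderiv_mem_restrictTotalDegree hk i)
      have h1 := P.smul_mem (s.a i) hp
      rw [smul_smul, a_mul_ev, add_smul, mul_smul] at h1
      exact (P.add_mem_iff_right (P.smul_mem _ (hv i))).1 h1

lemma exists_of_mem_sup (s : WeylSystem K n) {N : Submodule (Weyl K n) M} {v : M}
    (hv : ∀ i, s.a i • v ∈ N) {m : M} (hm : m ∈ N ⊔ Submodule.span (Weyl K n) {v}) :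
    ∃ u ∈ N, ∃ p, u + s.ev p • v = m := by
  let Q : Submodule K M := N.restrictScalars K ⊔ (LinearMap.range (s.evMap v))
  have hG : IsLinearFiltration K n (fun _ => Q) := by
    refine IsLinearFiltration.of_system s (fun _ _ _ => le_rfl) ?_ ?_
    · intro i _ m hm
      obtain ⟨u, hu, _, ⟨p, rfl⟩, rfl⟩ := Submodule.mem_sup.1 hm
      rw [smul_add, evMap_apply, smul_smul, a_mul_ev, add_smul, mul_smul, ← add_assoc]
      exact Submodule.add_mem_sup (N.add_mem (N.smul_mem _ hu) (N.smul_mem _ (hv i))) ⟨_, rfl⟩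
    · intro i _ m hm
      obtain ⟨u, hu, _, ⟨p, rfl⟩, rfl⟩ := Submodule.mem_sup.1 hm
      rw [smul_add, evMap_apply, smul_smul, ← ev_X, ← map_mul]
      exact Submodule.add_mem_sup (N.smul_mem _ hu) ⟨_, rfl⟩
  have hvQ : v ∈ Q := Submodule.mem_sup_right ⟨1, by simp⟩
  obtain ⟨u, hu, x, hx, rfl⟩ := Submodule.mem_sup.1 hm
  obtain ⟨w, rfl⟩ := Submodule.mem_span_singleton.1 hx
  have h1 : u + w • v ∈ Q := Q.add_mem (Submodule.mem_sup_left hu)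
    (weyl_smul_mem (fun w hw m hm => hG w hw 0 m hm) w v hvQ)
  obtain ⟨u', hu', _, ⟨p, rfl⟩, h⟩ := Submodule.mem_sup.1 h1
  exact ⟨u', hu', p, h⟩

lemma covBy_sup [CharZero K] (s : WeylSystem K n) {N : Submodule (Weyl K n) M} {v : M}
    (hvN : v ∉ N) (hv : ∀ i, s.a i • v ∈ N) : N ⋖ N ⊔ Submodule.span (Weyl K n) {v} := by
  constructor
  · exact lt_of_le_of_ne le_sup_left fun h => hvN (h ▸
      Submodule.mem_sup_right (Submodule.mem_span_singleton_self v))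
  · intro P hNP hP
    obtain ⟨m, hmP, hmN⟩ := SetLike.exists_of_lt hNP
    obtain ⟨u, hu, p, rfl⟩ := s.exists_of_mem_sup hv (hP.le hmP)
    have hp0 : p ≠ 0 := by
      rintro rfl
      simp [hu] at hmN
    have h1 : s.ev p • v ∈ P := (P.add_mem_iff_right (hNP.le hu)).1 hmP
    have h2 : v ∈ P := s.mem_of_ev_smul_mem (fun i => hNP.le (hv i)) hp0 h1
    exact hP.not_ge (sup_le hNP.le ((Submodule.span_singleton_le_iff_mem _ _).2 h2))

end WeylSystem

/-- `IsWeylFlag r N`: the submodule `N` is obtained from `0` by successively adjoining `r`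
vectors, each annihilated by the `a_i` of some canonical generators modulo the previous ones. -/
inductive IsWeylFlag (K : Type) [Field K] (n : ℕ) {M : Type} [AddCommGroup M] [Module K M]
    [Module (Weyl K n) M] : ℕ → Submodule (Weyl K n) M → Prop
  | bot : IsWeylFlag K n 0 ⊥
  | snoc {r : ℕ} {N : Submodule (Weyl K n) M} (h : IsWeylFlag K n r N) (s : WeylSystem K n)
      {v : M} (hvN : v ∉ N) (hv : ∀ i, s.a i • v ∈ N) :
      IsWeylFlag K n (r + 1) (N ⊔ Submodule.span (Weyl K n) {v})

namespace IsWeylFlag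

lemma exists_compositionSeries [CharZero K] {r : ℕ} {N : Submodule (Weyl K n) M}
    (h : IsWeylFlag K n r N) :
    ∃ s : CompositionSeries (Submodule (Weyl K n) M), s.head = ⊥ ∧ s.last = N ∧ s.length = r := by
  induction h with
  | bot => exact ⟨RelSeries.singleton _ ⊥, rfl, rfl, rfl⟩
  | @snoc r N _ s v hvN hv ih =>
    obtain ⟨t, h1, h2, h3⟩ := ih
    refine ⟨RelSeries.snoc t _ (h2 ▸ s.covBy_sup hvN hv), ?_, ?_, ?_⟩
    · simpa using h1
    · simp [h2]
    · simp [h3]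

lemma mlength_eq [CharZero K] {r : ℕ} (h : IsWeylFlag K n r (⊤ : Submodule (Weyl K n) M)) :
    mlength (Weyl K n) M = r := by
  obtain ⟨s, h1, h2, h3⟩ := h.exists_compositionSeries
  rw [mlength, ← Module.coe_length, ← Module.length_compositionSeries s h1 h2, h3]
  rfl

lemma exists_filtration {r : ℕ} {N : Submodule (Weyl K n) M} (h : IsWeylFlag K n r N) :
    ∃ G : ℕ → Submodule K M, IsLinearFiltration K n G ∧ (∀ m ∈ N, ∃ k, m ∈ G k) ∧
      (∀ k, FiniteDimensional K (G k)) ∧ ∃ c, ∀ k, Module.finrank K (G k) ≤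
        r * Module.finrank K (MvPolynomial.restrictTotalDegree (Fin n) K (k + c)) := by
  induction h with
  | bot =>
    refine ⟨fun _ => ⊥, ?_, ?_, fun k => inferInstance, 0, ?_⟩
    · rintro w - k m hm
      rw [Submodule.mem_bot] at hm ⊢
      rw [hm, smul_zero]
    · intro m hm
      exact ⟨0, hm⟩
    · simp
  | @snoc r N _ s v hvN hv ih =>
    obtain ⟨G, hG, hex, hfin, c, hc⟩ := ih
    obtain ⟨c₀, hc₀⟩ : ∃ c₀, ∀ i, s.a i • v ∈ G c₀ := by
      choose k hk using fun i => hex _ (hv i)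
      exact ⟨Finset.univ.sup k, fun i => hG.mono (Finset.le_sup (Finset.mem_univ i)) (hk i)⟩
    refine ⟨fun k => G (c₀ + k) ⊔
      (MvPolynomial.restrictTotalDegree (Fin n) K k).map (s.evMap v), ?_, ?_, ?_, c₀ + c, ?_⟩
    · refine IsLinearFiltration.of_system s ?_ ?_ ?_
      · intro j k hjk
        exact sup_le_sup (hG.mono (Nat.add_le_add_left hjk _))
          (Submodule.map_mono (restrictTotalDegree_mono hjk))
      · intro i k m hm
        obtain ⟨u, hu, _, ⟨p, hp, rfl⟩, rfl⟩ := Submodule.mem_sup.1 hm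
        rw [smul_add, WeylSystem.evMap_apply, smul_smul, WeylSystem.a_mul_ev, add_smul, mul_smul,
          ← add_assoc (s.a i • u)]
        refine Submodule.add_mem_sup (add_mem ?_ ?_) ⟨_, ?_, rfl⟩
        · exact hG _ (s.a_mem i) _ _ hu
        · exact hG.mono (by omega) (hG.ev_smul_mem s hp (hc₀ i))
        · exact restrictTotalDegree_mono k.le_succ
            (pderiv_mem_restrictTotalDegree (restrictTotalDegree_mono k.le_succ hp) i)
      · intro i k m hm
        obtain ⟨u, hu, _, ⟨p, hp, rfl⟩, rfl⟩ := Submodule.mem_sup.1 hm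
        rw [smul_add, WeylSystem.evMap_apply, smul_smul, ← WeylSystem.ev_X, ← map_mul]
        refine Submodule.add_mem_sup ?_ ⟨_, X_mul_mem_restrictTotalDegree hp i, rfl⟩
        rw [WeylSystem.ev_X]
        exact hG _ (s.b_mem i) _ _ hu
    · intro m hm
      obtain ⟨u, hu, p, rfl⟩ := s.exists_of_mem_sup hv hm
      obtain ⟨k, hk⟩ := hex u hu
      refine ⟨k + p.totalDegree, Submodule.add_mem_sup (hG.mono (by omega) hk) ⟨p, ?_, rfl⟩⟩
      exact (MvPolynomial.mem_restrictTotalDegree _ _ _).2 (by omega)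
    · intro k
      have := hfin (c₀ + k)
      infer_instance
    · intro k
      have := hfin (c₀ + k)
      refine (Submodule.finrank_add_le_finrank_add_finrank _ _).trans ?_
      rw [add_mul, one_mul]
      have e : k + (c₀ + c) = c₀ + k + c := by omega
      rw [e]
      refine add_le_add (hc _) ((Submodule.finrank_map_le _ _).trans ?_)
      exact Submodule.finrank_mono (restrictTotalDegree_mono (by omega))

lemma exists_le_finrank [CharZero K] {r : ℕ} {N : Submodule (Weyl K n) M}
    (h : IsWeylFlag K n r N) {F : ℕ → Submodule K M} (hF : IsLinearFiltration K n F)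
    (hex : ∀ m, ∃ k, m ∈ F k) (hfin : ∀ k, FiniteDimensional K (F k)) :
    ∃ c, ∀ k, r * Module.finrank K (MvPolynomial.restrictTotalDegree (Fin n) K k) ≤
      Module.finrank K (F (k + c) ⊓ N.restrictScalars K : Submodule K M) := by
  induction h with
  | bot => exact ⟨0, by simp⟩
  | @snoc r N _ s v hvN hv ih =>
    obtain ⟨c, hc⟩ := ih
    obtain ⟨d, hd⟩ := hex v
    refine ⟨c + d, fun k => ?_⟩
    set V := (MvPolynomial.restrictTotalDegree (Fin n) K k).map (s.evMap v) with hV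
    have hinj : Function.Injective (s.evMap v) := by
      rw [injective_iff_map_eq_zero]
      intro p hp
      by_contra hp0
      refine hvN (s.mem_of_ev_smul_mem hv hp0 ?_)
      rw [← WeylSystem.evMap_apply, hp]
      exact zero_mem _
    have hVd : Module.finrank K V =
        Module.finrank K (MvPolynomial.restrictTotalDegree (Fin n) K k) :=
      (Submodule.equivMapOfInjective _ hinj _).finrank_eq.symm
    have := hfin (k + (c + d))
    have hVF : V ≤ F (k + (c + d)) := by
      rintro _ ⟨p, hp, rfl⟩
      exact hF.mono (by omega) (hF.ev_smul_mem s hp hd)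
    have hdisj : (F (k + (c + d)) ⊓ N.restrictScalars K : Submodule K M) ⊓ V = ⊥ := by
      rw [eq_bot_iff]
      rintro _ ⟨⟨_, hN⟩, ⟨p, hp, rfl⟩⟩
      by_contra h0
      refine hvN (s.mem_of_ev_smul_mem hv (p := p) ?_ hN)
      rintro rfl
      exact h0 (by simp)
    have hVfin : FiniteDimensional K V := Submodule.finiteDimensional_of_le hVF
    have hsum := Submodule.finrank_sup_add_finrank_inf_eq
      (F (k + (c + d)) ⊓ N.restrictScalars K : Submodule K M) V
    rw [hdisj, finrank_bot, add_zero, hVd] at hsum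
    have hle : (F (k + (c + d)) ⊓ N.restrictScalars K : Submodule K M) ⊔ V ≤
        F (k + (c + d)) ⊓ (N ⊔ Submodule.span (Weyl K n) {v}).restrictScalars K := by
      refine sup_le (inf_le_inf_left _ fun m hm => ?_) (le_inf hVF ?_)
      · exact Submodule.mem_sup_left hm
      · rintro _ ⟨p, _, rfl⟩
        exact Submodule.mem_sup_right
          (Submodule.smul_mem _ _ (Submodule.mem_span_singleton_self v))
    have hmono : (F (k + c) ⊓ N.restrictScalars K : Submodule K M) ≤
        F (k + (c + d)) ⊓ N.restrictScalars K := inf_le_inf_right _ (hF.mono (by omega))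
    have h1 := Submodule.finrank_mono hle
    have h2 := Submodule.finrank_mono hmono
    have h3 := hc k
    rw [add_mul, one_mul]
    omega

end IsWeylFlag

end WeylFlags

section Multiplicity

lemma Polynomial.factorial_mul_leadingCoeff_of_choose_bounds {h : Polynomial ℚ} {r n c N : ℕ}
    (hl : ∀ k ≥ N, (r * (k + n).choose n : ℚ) ≤ h.eval ((k + c : ℕ) : ℚ))
    (hu : ∀ k ≥ N, h.eval (k : ℚ) ≤ r * ((k + c + n).choose n : ℚ)) :
    (Nat.factorial h.natDegree : ℚ) * h.leadingCoeff = r := by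
  rcases Nat.eq_zero_or_pos r with rfl | hr
  · have h0 : h = 0 := by
      refine Polynomial.eq_zero_of_infinite_isRoot h (Set.Infinite.mono (s := (fun k : ℕ => ((k + c : ℕ) : ℚ)) '' Set.Ici N) ?_ ?_)
      · rintro _ ⟨k, hk, rfl⟩
        have h1 := hl k hk
        have h2 := hu (k + c) (le_trans hk (Nat.le_add_right _ _))
        simp only [Nat.cast_zero, zero_mul] at h1 h2
        exact le_antisymm h2 h1
      · refine (Set.Ici_infinite N).image fun a _ b _ hab => ?_
        simpa using hab
    simp [h0]
  have hfac : (0 : ℚ) < n.factorial := by exact_mod_cast n.factorial_pos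
  have hrpos : (0 : ℚ) < r := by exact_mod_cast hr
  have hchoose : ∀ k : ℕ, (n.factorial * (k + n).choose n : ℚ) = (k + 1).ascFactorial n := by
    intro k
    exact_mod_cast (Nat.ascFactorial_eq_factorial_mul_choose k n).symm
  have hlow : ∀ k : ℕ, ((k + 1 : ℕ) : ℚ) ^ n ≤ n.factorial * (k + n).choose n := by
    intro k
    rw [hchoose]
    exact_mod_cast Nat.pow_succ_le_ascFactorial (k + 1) n
  have hupp : ∀ k : ℕ, (n.factorial * (k + n).choose n : ℚ) ≤ ((k + 1 + n : ℕ) : ℚ) ^ n := by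
    intro k
    rw [hchoose]
    exact_mod_cast (Nat.ascFactorial_le_pow_add k n).trans (Nat.pow_le_pow_left (by omega) n)
  set ρ : ℚ := r / n.factorial with hρ
  have hρpos : 0 < ρ := div_pos hrpos hfac
  have hlim : ∀ e : ℚ, Filter.Tendsto (fun k : ℕ =>
      (Polynomial.C ρ * (Polynomial.X + Polynomial.C e) ^ n).eval (k : ℚ) /
        (Polynomial.X ^ n : Polynomial ℚ).eval (k : ℚ)) Filter.atTop (nhds ρ) := by
    intro e
    have hlc : (Polynomial.C ρ * (Polynomial.X + Polynomial.C e) ^ n).leadingCoeff = ρ := by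
      rw [Polynomial.leadingCoeff_mul, Polynomial.leadingCoeff_C, Polynomial.leadingCoeff_pow,
        Polynomial.leadingCoeff_X_add_C, one_pow, mul_one]
    have hdeg : (Polynomial.C ρ * (Polynomial.X + Polynomial.C e) ^ n).degree =
        (Polynomial.X ^ n : Polynomial ℚ).degree := by
      rw [Polynomial.degree_C_mul hρpos.ne', Polynomial.degree_pow, Polynomial.degree_pow,
        Polynomial.degree_X_add_C, Polynomial.degree_X]
    have := (Polynomial.div_tendsto_atTop_leadingCoeff_div_of_degree_eq _ _ hdeg).comp
      (tendsto_natCast_atTop_atTop (R := ℚ))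
    rwa [hlc, Polynomial.leadingCoeff_X_pow, div_one] at this
  have hh : Filter.Tendsto (fun k : ℕ => h.eval (k : ℚ) /
      (Polynomial.X ^ n : Polynomial ℚ).eval (k : ℚ)) Filter.atTop (nhds ρ) := by
    refine tendsto_of_tendsto_of_tendsto_of_le_of_le' (hlim (1 - c)) (hlim (c + 1 + n)) ?_ ?_
    · filter_upwards [Filter.eventually_ge_atTop (N + c)] with k hk
      obtain ⟨j, rfl⟩ := Nat.exists_eq_add_of_le' (le_trans (Nat.le_add_left c N) hk)
      refine div_le_div_of_nonneg_right ?_ (by simp; positivity)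
      refine le_trans ?_ (hl j (by omega))
      have h1 := mul_le_mul_of_nonneg_left (hlow j) hρpos.le
      simp only [Polynomial.eval_mul, Polynomial.eval_C, Polynomial.eval_pow, Polynomial.eval_add,
        Polynomial.eval_X]
      push_cast at h1 ⊢
      calc ρ * ((j : ℚ) + c + (1 - c)) ^ n = ρ * ((j : ℚ) + 1) ^ n := by ring
        _ ≤ _ := h1
        _ = _ := by rw [hρ]; field_simp
    · filter_upwards [Filter.eventually_ge_atTop N] with k hk
      refine div_le_div_of_nonneg_right ((hu k hk).trans ?_) (by simp)
      have h1 := mul_le_mul_of_nonneg_left (hupp (k + c)) hρpos.le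
      simp only [Polynomial.eval_mul, Polynomial.eval_C, Polynomial.eval_pow, Polynomial.eval_add,
        Polynomial.eval_X]
      push_cast at h1 ⊢
      calc (r : ℚ) * ((k + c + n).choose n : ℚ)
          = ρ * (n.factorial * ((k + c + n).choose n : ℚ)) := by rw [hρ]; field_simp
        _ ≤ _ := h1
        _ = _ := by ring
  have hXn : (Polynomial.X ^ n : Polynomial ℚ) ≠ 0 := pow_ne_zero _ Polynomial.X_ne_zero
  have hcast := tendsto_natCast_atTop_atTop (R := ℚ)
  rcases lt_trichotomy h.degree (Polynomial.X ^ n : Polynomial ℚ).degree with hd | hd | hd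
  · have := (Polynomial.div_tendsto_atTop_zero_of_degree_lt _ _ hd).comp hcast
    exact absurd (tendsto_nhds_unique hh this) hρpos.ne'
  · have h1 := (Polynomial.div_tendsto_atTop_leadingCoeff_div_of_degree_eq _ _ hd).comp hcast
    have h2 := tendsto_nhds_unique hh h1
    rw [Polynomial.leadingCoeff_X_pow, div_one] at h2
    have h3 : h.natDegree = n := by
      rw [Polynomial.degree_X_pow] at hd
      exact Polynomial.natDegree_eq_of_degree_eq_some hd
    rw [h3, ← h2, hρ]
    field_simp
  · have h1 := (Polynomial.abs_div_tendsto_atTop_atTop_of_degree_gt _ _ hd hXn).comp hcast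
    exact absurd hh.abs (not_tendsto_nhds_of_tendsto_atTop h1 _)

variable {K : Type} [Field K] {n : ℕ}

lemma finrank_restrictTotalDegree (k : ℕ) :
    Module.finrank K (MvPolynomial.restrictTotalDegree (Fin n) K k) = (k + n).choose n := by
  classical
  have hset : {e : Fin n →₀ ℕ | (e.sum fun _ x => x) ≤ k} =
      ((Finset.range (k + 1)).biUnion fun j => (Finset.univ : Finset (Fin n)).finsuppAntidiag j :
        Finset (Fin n →₀ ℕ)) := by
    ext e
    simp [Finsupp.sum_fintype]
  rw [MvPolynomial.restrictTotalDegree,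
    Module.finrank_eq_nat_card_basis (MvPolynomial.basisRestrictSupport K _), hset,
    Nat.card_eq_card_toFinset, Finset.toFinset_coe, Finset.card_biUnion]
  · simp only [Finset.card_finsuppAntidiag_nat_eq_multichoose, Finset.card_univ, Fintype.card_fin]
    exact Nat.sum_range_multichoose k n
  · intro i _ j _ hij
    rw [Function.onFun, Finset.disjoint_left]
    intro e hi hj
    rw [Finset.mem_finsuppAntidiag] at hi hj
    exact hij (hi.1.symm.trans hj.1)

lemma weylLinear_le_bernsteinF : weylLinear K n ≤ bernsteinF K n 1 := by
  have hone : ∀ (u : Fin n → Weyl K n) (i : Fin n),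
      ((List.finRange n).map fun j => u j ^ (Pi.single i 1 : Fin n → ℕ) j).prod = u i := by
    intro u i
    rw [List.prod_map_eq_pow_single i, List.count_eq_one_of_mem (List.nodup_finRange n)
      (List.mem_finRange i)]
    · simp
    · intro j hj _
      simp [hj]
  have hsum : ∀ i : Fin n, ∑ j, (Pi.single i 1 : Fin n → ℕ) j = 1 := fun i => by simp
  refine Submodule.span_mono ?_
  rintro _ (rfl | ⟨i, rfl⟩ | ⟨i, rfl⟩)
  · exact ⟨0, 0, by simp, by simp⟩
  · exact ⟨Pi.single i 1, 0, by rw [hsum]; simp, by rw [hone]; simp⟩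
  · exact ⟨0, Pi.single i 1, by rw [hsum]; simp, by rw [hone]; simp⟩

variable {M : Type} [AddCommGroup M] [Module K M] [Module (Weyl K n) M]
  [IsScalarTower K (Weyl K n) M]

lemma IsLinearFiltration.bernsteinF_smul_mem {G : ℕ → Submodule K M}
    (hG : IsLinearFiltration K n G) {j c : ℕ} {w : Weyl K n} (hw : w ∈ bernsteinF K n j)
    {m : M} (hm : m ∈ G c) : w • m ∈ G (c + j) := by
  have hpow : ∀ u ∈ weylLinear K n, ∀ (e c : ℕ) (m : M), m ∈ G c → u ^ e • m ∈ G (c + e) := by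
    intro u hu e
    induction e with
    | zero => intro c m hm; simpa using hm
    | succ e ih => intro c m hm; rw [pow_succ', mul_smul]; exact hG u hu _ _ (ih c m hm)
  have hprod : ∀ (u : Fin n → Weyl K n), (∀ i, u i ∈ weylLinear K n) → ∀ (e : Fin n → ℕ)
      (l : List (Fin n)) (c : ℕ) (m : M), m ∈ G c →
      (l.map fun i => u i ^ e i).prod • m ∈ G (c + (l.map e).sum) := by
    intro u hu e l
    induction l with
    | nil => intro c m hm; simpa using hm
    | cons i l ih =>
      intro c m hm
      simp only [List.map_cons, List.prod_cons, mul_smul, List.sum_cons]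
      rw [add_comm (e i), ← add_assoc]
      exact hpow _ (hu i) _ _ _ (ih c m hm)
  have hsum : ∀ e : Fin n → ℕ, ((List.finRange n).map e).sum = ∑ i, e i := fun e => by
    rw [← List.ofFn_eq_map, List.sum_ofFn]
  induction hw using Submodule.span_induction with
  | mem x hx =>
    obtain ⟨α, β, hle, rfl⟩ := hx
    rw [mul_smul]
    have h1 := hprod _ wX_mem_weylLinear α (List.finRange n) _ _
      (hprod _ wD_mem_weylLinear β (List.finRange n) _ _ hm)
    rw [hsum, hsum] at h1
    refine hG.mono ?_ h1
    have : (∑ i, α i) + (∑ i, β i) ≤ j := by exact_mod_cast hle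
    omega
  | zero => rw [zero_smul]; exact zero_mem _
  | add x y _ _ hx hy => rw [add_smul]; exact add_mem hx hy
  | smul r x _ hx => rw [smul_assoc]; exact Submodule.smul_mem _ r hx

/-- Any good Bernstein filtration of a module with a flag of length `r` gives multiplicity `r`. -/
theorem IsWeylFlag.eq_of_hasMult [CharZero K] {r : ℕ}
    (hr : IsWeylFlag K n r (⊤ : Submodule (Weyl K n) M)) {m : ℚ} (hm : HasMult K n M m) :
    m = r := by
  obtain ⟨F, hF, h, ⟨N, hN⟩, rfl⟩ := hm
  have hmono : Monotone F := monotone_int_of_le_succ hF.mono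
  have hlin : IsLinearFiltration K n (fun k : ℕ => F k) := by
    intro w hw k x hx
    have := hF.compat 1 k w (weylLinear_le_bernsteinF hw) x hx
    rw [add_comm] at this
    exact_mod_cast this
  have hex : ∀ x : M, ∃ k : ℕ, x ∈ F k := fun x => by
    obtain ⟨k, hk⟩ := hF.exhaustive x
    exact ⟨k.toNat, hmono k.self_le_toNat hk⟩
  obtain ⟨c, hc⟩ := hr.exists_le_finrank hlin hex fun k => hF.finiteDim k
  obtain ⟨G, hG, hGex, hGfin, d, hd⟩ := hr.exists_filtration
  obtain ⟨k₁, hk₁⟩ := hF.good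
  set k₂ := k₁.toNat
  obtain ⟨e, he⟩ : ∃ e, F k₂ ≤ G e := by
    have := hF.finiteDim k₂
    obtain ⟨S, hS⟩ := (Submodule.fg_iff_finiteDimensional (F k₂)).2 this
    choose k hk using fun x : M => hGex x trivial
    refine ⟨S.sup k, ?_⟩
    rw [← hS, Submodule.span_le]
    intro x hx
    exact hG.mono (Finset.le_sup hx) (hk x)
  have hFG : ∀ j : ℕ, F (j + k₂ : ℕ) ≤ G (e + j) := by
    intro j
    push_cast
    refine (hk₁ k₂ k₁.self_le_toNat j (Int.natCast_nonneg j)).trans (Submodule.span_le.2 ?_)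
    rintro _ ⟨w, hw, v, hv, rfl⟩
    exact hG.bernsteinF_smul_mem hw (he hv)
  have hN' : ∀ k : ℕ, N.toNat ≤ k → (Module.finrank K (F k) : ℚ) = h.eval (k : ℚ) := by
    intro k hk
    exact_mod_cast hN k (by omega)
  refine Polynomial.factorial_mul_leadingCoeff_of_choose_bounds (n := n) (c := c + e + d)
    (N := N.toNat + k₂) ?_ ?_
  · intro k hk
    rw [← hN' _ (by omega), ← finrank_restrictTotalDegree (K := K) k]
    have h1 := hc k
    have h2 : (F (k + c : ℕ) ⊓ (⊤ : Submodule (Weyl K n) M).restrictScalars K : Submodule K M) ≤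
        F (k + (c + e + d) : ℕ) :=
      inf_le_left.trans (hmono (by push_cast; omega))
    have := hF.finiteDim (k + (c + e + d) : ℕ)
    exact_mod_cast h1.trans (Submodule.finrank_mono h2)
  · intro k hk
    rw [← hN' _ (by omega), ← finrank_restrictTotalDegree (K := K)]
    obtain ⟨j, rfl⟩ := Nat.exists_eq_add_of_le' (le_trans (Nat.le_add_left k₂ _) hk)
    have := hGfin (e + j)
    have h1 := (Submodule.finrank_mono (hFG j)).trans (hd _)
    have h2 := Submodule.finrank_mono (restrictTotalDegree_mono (K := K) (n := n)
      (show e + j + d ≤ j + k₂ + (c + e + d) by omega))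
    exact_mod_cast h1.trans (Nat.mul_le_mul_left r h2)

end Multiplicity

section LinearForms

variable {K : Type} [Field K] {n : ℕ}

/-- The gradient of a polynomial of degree at most one. -/
noncomputable def linearPart (p : MvPolynomial (Fin n) K) : Fin n → K :=
  fun i => MvPolynomial.coeff (Finsupp.single i 1) p

/-- The polynomial of degree at most one with gradient `v` and constant term `c`. -/
noncomputable def affineForm (v : Fin n → K) (c : K) : MvPolynomial (Fin n) K :=
  ∑ i, MvPolynomial.C (v i) * MvPolynomial.X i + MvPolynomial.C c

lemma eq_affineForm_of_totalDegree_le_one {p : MvPolynomial (Fin n) K} (hp : p.totalDegree ≤ 1) :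
    p = affineForm (linearPart p) (MvPolynomial.coeff 0 p) := by
  classical
  ext e
  simp only [affineForm, linearPart, MvPolynomial.coeff_add, MvPolynomial.coeff_sum,
    MvPolynomial.coeff_C_mul, MvPolynomial.coeff_C, MvPolynomial.coeff_X]
  rcases Nat.lt_or_ge 1 e.degree with he | he
  · have h1 : MvPolynomial.coeff e p = 0 := by
      by_contra h
      exact absurd ((MvPolynomial.le_totalDegree (MvPolynomial.mem_support_iff.2 h)).trans hp)
        (not_le.2 he)
    have h2 : ∀ i, Finsupp.single i 1 ≠ e := by
      rintro i rfl
      simp at he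
    have h3 : (0 : Fin n →₀ ℕ) ≠ e := by
      rintro rfl
      simp at he
    simp [h1, h2, h3]
  · rcases Nat.le_one_iff_eq_zero_or_eq_one.1 he with he | he
    · rw [Finsupp.degree_eq_zero_iff] at he
      subst he
      simp
    · obtain ⟨i, rfl⟩ : ∃ i, e = Finsupp.single i 1 := by
        obtain ⟨i, hi⟩ : ∃ i, e i ≠ 0 := by
          by_contra! h0
          have : e = 0 := Finsupp.ext h0
          simp [this] at he
        have hle : Finsupp.single i 1 ≤ e := by
          rw [Finsupp.single_le_iff]; omega
        obtain ⟨e', rfl⟩ := exists_add_of_le hle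
        rw [map_add, Finsupp.degree_single] at he
        have : e' = 0 := (Finsupp.degree_eq_zero_iff e').1 (by omega)
        exact ⟨i, by rw [this, add_zero]⟩
      have h3 : (0 : Fin n →₀ ℕ) ≠ Finsupp.single i 1 := fun h => by
        simpa using DFunLike.congr_fun h i
      rw [Finset.sum_eq_single i]
      · simp [h3]
      · intro j _ hj
        simp [Finsupp.single_left_inj, hj]
      · simp

lemma pderiv_affineForm (v : Fin n → K) (c : K) (i : Fin n) :
    MvPolynomial.pderiv i (affineForm v c) = MvPolynomial.C (v i) := by
  classical
  simp [affineForm, MvPolynomial.pderiv_X, Pi.single_apply]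

lemma sum_smul_affineForm {κ : Type} (s : Finset κ) (t : κ → K) (v : κ → Fin n → K) (c : κ → K) :
    ∑ k ∈ s, t k • affineForm (v k) (c k) = affineForm (∑ k ∈ s, t k • v k) (∑ k ∈ s, t k * c k) := by
  simp only [affineForm, smul_add, Finset.sum_add_distrib, Finset.smul_sum, map_sum,
    Finset.sum_apply, Pi.smul_apply, smul_eq_mul, Finset.sum_mul, map_mul]
  rw [Finset.sum_comm]
  simp only [MvPolynomial.smul_eq_C_mul, mul_assoc]

lemma exists_matrix_of_linearIndependent {σ : Type} [Fintype σ] {v : σ → Fin n → K}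
    (hv : LinearIndependent K v) :
    ∃ P Q : Matrix (Fin n) (Fin n) K, P * Q = 1 ∧
      ∃ τ : σ → Fin n, Function.Injective τ ∧ ∀ s, P (τ s) = v s := by
  classical
  have hs := hv.linearIndepOn_id
  let B := Module.Basis.extend hs
  have : Finite (hs.extend (Set.subset_univ _)) := Module.Finite.finite_basis B
  have := Fintype.ofFinite (hs.extend (Set.subset_univ _))
  have hcard : Fintype.card (hs.extend (Set.subset_univ _)) = n := by
    rw [← Module.finrank_eq_card_basis B, Module.finrank_fin_fun]
  let e := Fintype.equivFinOfCardEq hcard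
  let P : Matrix (Fin n) (Fin n) K := Matrix.of (B.reindex e)
  have hP : IsUnit P := Matrix.linearIndependent_rows_iff_isUnit.1 (B.reindex e).linearIndependent
  refine ⟨P, P⁻¹, Matrix.mul_nonsing_inv P ((Matrix.isUnit_iff_isUnit_det P).1 hP),
    fun s => e ⟨v s, hs.subset_extend _ ⟨s, rfl⟩⟩, ?_, ?_⟩
  · intro s t hst
    exact hv.injective (congrArg Subtype.val (e.injective hst))
  · intro s
    change B.reindex e (e _) = v s
    simp [B]

end LinearForms

namespace WeylSystem

variable {K : Type} [Field K] {n : ℕ} (P Q : Matrix (Fin n) (Fin n) K) (c : Fin n → K)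

/-- The affine coordinates `∑ P_ji x_i + c_j`. -/
noncomputable def coord (j : Fin n) : Weyl K n := ∑ i, P j i • wX K n i + c j • 1

/-- The derivations `∑ Q_ij ∂_i`. -/
noncomputable def dir (j : Fin n) : Weyl K n := ∑ i, Q i j • wD K n i

lemma coord_comm (i j : Fin n) : coord P c i * coord P c j = coord P c j * coord P c i := by
  have h : ∀ k, Commute (wX K n k) (coord P c j) := fun k =>
    (Commute.sum_right _ _ _ fun l _ => Commute.smul_right (wX_comm k l) _).add_right
      ((Commute.one_right _).smul_right _)
  exact ((Commute.sum_left _ _ _ fun k _ => (h k).smul_left _).add_left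
    ((Commute.one_left _).smul_left _)).eq

lemma dir_comm (i j : Fin n) : dir Q i * dir Q j = dir Q j * dir Q i :=
  (Commute.sum_left _ _ _ fun _ _ => (Commute.sum_right _ _ _ fun _ _ =>
    Commute.smul_right (wD_comm _ _) _).smul_left _).eq

lemma wD_mul_coord (i j : Fin n) :
    wD K n i * coord P c j = coord P c j * wD K n i + P j i • 1 := by
  simp only [coord, mul_add, add_mul, Finset.mul_sum, Finset.sum_mul, mul_smul_comm,
    smul_mul_assoc, wD_mul_wX, smul_add, Finset.sum_add_distrib, mul_one, one_mul]
  simp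
  abel

variable {P Q}

lemma dir_mul_coord (h : P * Q = 1) (i j : Fin n) :
    dir Q i * coord P c j = coord P c j * dir Q i + if i = j then 1 else 0 := by
  have h1 : ∑ k, Q k i * P j k = if i = j then 1 else 0 := by
    have := congrFun (congrFun h j) i
    rw [Matrix.mul_apply, Matrix.one_apply] at this
    simp only [mul_comm (Q _ _), this, eq_comm]
  calc dir Q i * coord P c j
      = coord P c j * dir Q i + (∑ k, Q k i * P j k) • (1 : Weyl K n) := by
        simp only [dir, Finset.mul_sum, Finset.sum_mul, mul_smul_comm, smul_mul_assoc,
          wD_mul_coord, smul_add, Finset.sum_add_distrib, Finset.sum_smul, smul_smul]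
    _ = _ := by rw [h1]; split_ifs <;> simp

lemma coord_mem_weylLinear (j : Fin n) : coord P c j ∈ weylLinear K n :=
  add_mem (sum_mem fun i _ => Submodule.smul_mem _ _ (wX_mem_weylLinear i))
    (Submodule.smul_mem _ _ one_mem_weylLinear)

lemma dir_mem_weylLinear (j : Fin n) : dir Q j ∈ weylLinear K n :=
  sum_mem fun i _ => Submodule.smul_mem _ _ (wD_mem_weylLinear i)

lemma weylLinear_le_of_mem (h : P * Q = 1) {V : Submodule K (Weyl K n)} (h1 : 1 ∈ V)
    (hc : ∀ j, coord P c j ∈ V) (hd : ∀ j, dir Q j ∈ V) : weylLinear K n ≤ V := by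
  have h' : Q * P = 1 := mul_eq_one_comm.1 h
  have hQP : ∀ i k, ∑ j, Q i j * P j k = if i = k then 1 else 0 := fun i k => by
    rw [← Matrix.mul_apply, h', Matrix.one_apply]
  refine Submodule.span_le.2 ?_
  rintro _ (rfl | ⟨i, rfl⟩ | ⟨i, rfl⟩)
  · exact h1
  · have : wX K n i = ∑ j, Q i j • (coord P c j - c j • 1) := by
      simp only [coord, add_sub_cancel_right, Finset.smul_sum, smul_smul]
      rw [Finset.sum_comm]
      simp only [← Finset.sum_smul, hQP]
      simp
    rw [this]
    exact sum_mem fun j _ => V.smul_mem _ (sub_mem (hc j) (V.smul_mem _ h1))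
  · have : wD K n i = ∑ j, P j i • dir Q j := by
      simp only [dir, Finset.smul_sum, smul_smul]
      rw [Finset.sum_comm]
      simp only [← Finset.sum_smul, mul_comm (P _ _), hQP]
      simp
    rw [this]
    exact sum_mem fun j _ => V.smul_mem _ (hd j)

/-- The canonical generators in which the annihilation operators are the affine coordinates with
index in `J` and the derivations with index outside `J`. -/
noncomputable def ofMatrix (h : P * Q = 1) (J : Finset (Fin n)) : WeylSystem K n where
  a j := if j ∈ J then coord P c j else dir Q j
  b j := if j ∈ J then (-1 : K) • dir Q j else coord P c j
  comm i j := by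
    have h0 : ∀ i j, i ∈ J → j ∉ J → dir Q i * coord P c j = coord P c j * dir Q i := by
      intro i j hi hj
      have : i ≠ j := by rintro rfl; exact hj hi
      simpa [this] using dir_mul_coord c h i j
    by_cases hi : i ∈ J <;> by_cases hj : j ∈ J
    · simp [hi, hj, dir_comm Q i j]
    · simp [hi, hj, h0 i j hi hj]
    · simp [hi, hj, h0 j i hj hi]
    · simp [hi, hj, coord_comm P c i j]
  rel i j := by
    by_cases hi : i ∈ J <;> by_cases hj : j ∈ J
    · simp only [if_pos hi, if_pos hj, mul_smul_comm, smul_mul_assoc, dir_mul_coord c h j i, smul_add,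
        add_assoc]
      have h2 : (-1 : K) • (1 : Weyl K n) + 1 = 0 := by
        conv_lhs => rw [← one_smul K (1 : Weyl K n), smul_smul, ← add_smul]
        rw [mul_one, neg_add_cancel, zero_smul]
      by_cases hij : i = j
      · rw [if_pos hij, if_pos hij.symm, h2, add_zero]
      · rw [if_neg hij, if_neg (Ne.symm hij), smul_zero, add_zero, add_zero]
    · have : i ≠ j := by rintro rfl; exact hj hi
      simp [hi, hj, this, coord_comm P c i j]
    · have : i ≠ j := by rintro rfl; exact hi hj
      simp [hi, hj, this, dir_comm Q i j]
    · simp [hi, hj, dir_mul_coord c h i j]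
  a_mem i := by
    split_ifs
    · exact coord_mem_weylLinear c i
    · exact dir_mem_weylLinear i
  b_mem i := by
    split_ifs
    · exact Submodule.smul_mem _ _ (dir_mem_weylLinear i)
    · exact coord_mem_weylLinear c i
  le_span := by
    refine weylLinear_le_of_mem c h (Submodule.subset_span (Or.inl rfl)) ?_ ?_
    · intro j
      by_cases hj : j ∈ J
      · exact Submodule.subset_span (Or.inr (Or.inl ⟨j, by simp [hj]⟩))
      · exact Submodule.subset_span (Or.inr (Or.inr ⟨j, by simp [hj]⟩))
    · intro j
      by_cases hj : j ∈ J
      · rw [show dir Q j = (-1 : K) • (-1 : K) • dir Q j by rw [smul_smul]; simp]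
        exact Submodule.smul_mem _ _ (Submodule.subset_span (Or.inr (Or.inr ⟨j, by simp [hj]⟩)))
      · exact Submodule.subset_span (Or.inr (Or.inl ⟨j, by simp [hj]⟩))

end WeylSystem

/-- Inverses of affine forms in a `K[x]`-algebra `L` on which the Weyl algebra acts by
multiplication operators and derivations. -/
structure WeylArrangement (K : Type) [Field K] (n : ℕ) (L : Type) [CommRing L] [Algebra K L]
    [Algebra (MvPolynomial (Fin n) K) L] [Module (Weyl K n) L] (ι : Type) where
  /-- the action of the partial derivatives -/
  der : Fin n → Derivation K L L
  wX_smul : ∀ i (m : L), wX K n i • m = algebraMap (MvPolynomial (Fin n) K) L (MvPolynomial.X i) * m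
  wD_smul : ∀ i (m : L), wD K n i • m = der i m
  der_algebraMap : ∀ i (r : MvPolynomial (Fin n) K),
    der i (algebraMap _ L r) = algebraMap _ L (MvPolynomial.pderiv i r)
  /-- the gradients of the affine forms -/
  grad : ι → Fin n → K
  /-- the constant terms of the affine forms -/
  const : ι → K
  /-- the inverses of the affine forms -/
  inv : ι → L
  form_mul_inv' : ∀ i,
    algebraMap (MvPolynomial (Fin n) K) L (affineForm (grad i) (const i)) * inv i = 1

namespace WeylArrangement

variable {K : Type} [Field K] {n : ℕ} {L : Type} [CommRing L] [Algebra K L]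
  [Algebra (MvPolynomial (Fin n) K) L] [IsScalarTower K (MvPolynomial (Fin n) K) L]
  [Module (Weyl K n) L] [IsScalarTower K (Weyl K n) L] {ι : Type}
  (𝒜 : WeylArrangement K n L ι)

/-- The affine forms of the arrangement, as elements of `L`. -/
noncomputable def form (i : ι) : L := algebraMap (MvPolynomial (Fin n) K) L (affineForm (𝒜.grad i) (𝒜.const i))

/-- A set of hyperplanes is independent when their normal vectors are. -/
def Indep (S : Finset ι) : Prop := LinearIndependent K fun i : S => 𝒜.grad i

omit [IsScalarTower K (MvPolynomial (Fin n) K) L] [IsScalarTower K (Weyl K n) L] in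
lemma form_mul_inv (i : ι) : 𝒜.form i * 𝒜.inv i = 1 := 𝒜.form_mul_inv' i

omit [Module (Weyl K n) L] [IsScalarTower K (Weyl K n) L] in
lemma algebraMap_affineForm (v : Fin n → K) (c : K) :
    algebraMap (MvPolynomial (Fin n) K) L (affineForm v c) =
      ∑ i, v i • algebraMap (MvPolynomial (Fin n) K) L (MvPolynomial.X i) + c • 1 := by
  have hC : ∀ a : K, algebraMap (MvPolynomial (Fin n) K) L (MvPolynomial.C a) = a • 1 := fun a => by
    rw [← MvPolynomial.algebraMap_eq, ← IsScalarTower.algebraMap_apply, Algebra.algebraMap_eq_smul_one]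
  simp [affineForm, hC]

include 𝒜 in
lemma coord_smul (P : Matrix (Fin n) (Fin n) K) (c : Fin n → K) (j : Fin n) (m : L) :
    WeylSystem.coord P c j • m =
      algebraMap (MvPolynomial (Fin n) K) L (affineForm (P j) (c j)) * m := by
  simp only [WeylSystem.coord, add_smul, Finset.sum_smul, smul_assoc, 𝒜.wX_smul, one_smul,
    algebraMap_affineForm, add_mul, Finset.sum_mul, smul_mul_assoc, one_mul]

include 𝒜 in
lemma exists_derivation (Q : Matrix (Fin n) (Fin n) K) (j : Fin n) :
    ∃ D : Derivation K L L, (∀ m, WeylSystem.dir Q j • m = D m) ∧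
      ∀ v c, D (algebraMap _ L (affineForm v c)) = (∑ i, Q i j * v i) • 1 := by
  have h : ∀ m, (∑ i, Q i j • 𝒜.der i) m = ∑ i, Q i j • 𝒜.der i m := fun m => by
    rw [← Derivation.coeFnAddMonoidHom_apply, map_sum]
    simp
  refine ⟨∑ i, Q i j • 𝒜.der i, fun m => ?_, fun v c => ?_⟩
  · simp only [h, WeylSystem.dir, Finset.sum_smul, smul_assoc, 𝒜.wD_smul]
  · simp only [h, 𝒜.der_algebraMap, pderiv_affineForm, Finset.sum_smul, mul_smul]
    refine Finset.sum_congr rfl fun i _ => ?_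
    rw [← MvPolynomial.algebraMap_eq, ← IsScalarTower.algebraMap_apply,
      Algebra.algebraMap_eq_smul_one]

lemma exists_system {S : Finset ι} (hS : 𝒜.Indep S) :
    ∃ s : WeylSystem K n,
      (∀ j, (∃ i ∈ S, ∀ m : L, s.a j • m = 𝒜.form i * m) ∨
        ∃ D : Derivation K L L, (∀ m, s.a j • m = D m) ∧ ∀ i ∈ S, D (𝒜.form i) = 0) ∧
      ∀ i ∈ S, ∃ w : Weyl K n, ∃ D : Derivation K L L, (∀ m, w • m = D m) ∧
        D (𝒜.form i) = 1 ∧ ∀ k ∈ S, k ≠ i → D (𝒜.form k) = 0 := by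
  classical
  obtain ⟨P, Q, hPQ, τ, hτ, hP⟩ := exists_matrix_of_linearIndependent hS
  let c : Fin n → K := Function.extend τ (fun i => 𝒜.const i) 0
  have hc : ∀ i, c (τ i) = 𝒜.const i := fun i => hτ.extend_apply _ _ i
  have hQ : ∀ j (i : S), ∑ k, Q k j * 𝒜.grad i k = if τ i = j then 1 else 0 := fun j i => by
    rw [← Matrix.one_apply, ← hPQ, Matrix.mul_apply, ← hP i]
    simp only [mul_comm]
  refine ⟨WeylSystem.ofMatrix c hPQ (Finset.univ.image τ), fun j => ?_, fun i hi => ?_⟩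
  · by_cases hj : j ∈ Finset.univ.image τ
    · left
      obtain ⟨i, -, rfl⟩ := Finset.mem_image.1 hj
      refine ⟨i, i.2, fun m => ?_⟩
      change (if _ then _ else _ : Weyl K n) • m = _
      rw [if_pos hj, 𝒜.coord_smul, hc, hP, form]
    · right
      obtain ⟨D, h1, h2⟩ := 𝒜.exists_derivation Q j
      refine ⟨D, fun m => ?_, fun i hi => ?_⟩
      · change (if _ then _ else _ : Weyl K n) • m = _
        rw [if_neg hj, h1]
      · rw [form, h2, hQ j ⟨i, hi⟩, if_neg, zero_smul]
        rintro rfl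
        exact hj (Finset.mem_image_of_mem _ (Finset.mem_univ _))
  · obtain ⟨D, h1, h2⟩ := 𝒜.exists_derivation Q (τ ⟨i, hi⟩)
    refine ⟨_, D, h1, ?_, fun k hk hki => ?_⟩
    · rw [form, h2, hQ _ ⟨i, hi⟩, if_pos rfl, one_smul]
    · rw [form, h2, hQ _ ⟨k, hk⟩, if_neg, zero_smul]
      exact fun h => hki (congrArg Subtype.val (hτ h))

omit [IsScalarTower K (Weyl K n) L] in
lemma exists_relation {T : Finset ι} (hT : ¬ 𝒜.Indep T) :
    ∃ (t : ι → K) (c : K), ∑ i ∈ T, t i • 𝒜.form i = c • 1 ∧ ∃ i ∈ T, t i ≠ 0 := by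
  classical
  have h : ∃ t : ι → K, ∑ i ∈ T, t i • 𝒜.grad i = 0 ∧ ∃ i ∈ T, t i ≠ 0 := by
    obtain ⟨t, h1, i, h2⟩ := Fintype.not_linearIndependent_iff.1 hT
    refine ⟨fun i => if h : i ∈ T then t ⟨i, h⟩ else 0, ?_, i, i.2, by simpa using h2⟩
    rw [← Finset.sum_coe_sort]
    simpa using h1
  obtain ⟨t, h1, h2⟩ := h
  refine ⟨t, ∑ i ∈ T, t i * 𝒜.const i, ?_, h2⟩
  have h3 := congrArg (algebraMap (MvPolynomial (Fin n) K) L)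
    (sum_smul_affineForm T t 𝒜.grad 𝒜.const)
  rw [h1, algebraMap_affineForm, map_sum] at h3
  have h4 : ∀ (a : K) (p : MvPolynomial (Fin n) K),
      algebraMap (MvPolynomial (Fin n) K) L (a • p) = a • algebraMap _ L p := fun a p => by
    rw [Algebra.algebraMap_eq_smul_one, smul_assoc, ← Algebra.algebraMap_eq_smul_one]
  simpa [form, h4] using h3

variable [Fintype ι]

/-- The product of the inverse affine forms to the powers `m`. -/
noncomputable def frac (m : ι → ℕ) : L := ∏ i, 𝒜.inv i ^ m i

omit [IsScalarTower K (MvPolynomial (Fin n) K) L] [IsScalarTower K (Weyl K n) L] in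
lemma form_mul_frac_add [DecidableEq ι] (m : ι → ℕ) (i : ι) :
    𝒜.form i * 𝒜.frac (m + Pi.single i 1) = 𝒜.frac m := by
  have h : 𝒜.frac (m + Pi.single i 1) = 𝒜.inv i * 𝒜.frac m := by
    simp only [frac, Pi.add_apply, pow_add, Finset.prod_mul_distrib]
    rw [mul_comm, Finset.prod_eq_single i]
    · simp
    · intro j _ hj
      simp [hj]
    · simp
  rw [h, ← mul_assoc, 𝒜.form_mul_inv, one_mul]

omit [IsScalarTower K (MvPolynomial (Fin n) K) L] [IsScalarTower K (Weyl K n) L] in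
lemma inv_mul_frac [DecidableEq ι] (m : ι → ℕ) (i : ι) :
    𝒜.inv i * 𝒜.frac m = 𝒜.frac (m + Pi.single i 1) := by
  rw [← 𝒜.form_mul_frac_add m i, ← mul_assoc, mul_comm (𝒜.inv i), 𝒜.form_mul_inv, one_mul]

omit [IsScalarTower K (MvPolynomial (Fin n) K) L] [IsScalarTower K (Weyl K n) L] in
lemma derivation_frac (D : Derivation K L L) (m : ι → ℕ) :
    D (𝒜.frac m) = -(∑ i, m i * (𝒜.inv i * D (𝒜.form i))) * 𝒜.frac m := by
  classical
  have h1 : ∀ i (k : ℕ), D (𝒜.inv i ^ k) = -(k * (𝒜.inv i * D (𝒜.form i))) * 𝒜.inv i ^ k := by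
    intro i k
    have h : D (𝒜.inv i) = -𝒜.inv i ^ 2 • D (𝒜.form i) :=
      D.leibniz_of_mul_eq_one (by rw [mul_comm, 𝒜.form_mul_inv])
    rcases k with - | k
    · simp
    · rw [Derivation.leibniz_pow, h]
      simp only [Nat.add_sub_cancel, smul_eq_mul, nsmul_eq_mul]
      ring
  have h2 : ∀ s : Finset ι, D (∏ i ∈ s, 𝒜.inv i ^ m i) =
      -(∑ i ∈ s, m i * (𝒜.inv i * D (𝒜.form i))) * ∏ i ∈ s, 𝒜.inv i ^ m i := by
    intro s
    induction s using Finset.induction_on with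
    | empty => simp
    | insert i s hi ih =>
      rw [Finset.prod_insert hi, Finset.sum_insert hi, Derivation.leibniz, ih, h1]
      simp only [smul_eq_mul]
      ring
  exact h2 Finset.univ

/-- The exponents with value one on `S` and zero elsewhere. -/
def indicator [DecidableEq ι] (S : Finset ι) (i : ι) : ℕ := if i ∈ S then 1 else 0

variable [DecidableEq ι]

omit [IsScalarTower K (MvPolynomial (Fin n) K) L] [IsScalarTower K (Weyl K n) L] in
lemma form_mul_frac_indicator {S : Finset ι} {i : ι} (hi : i ∈ S) :
    𝒜.form i * 𝒜.frac (indicator S) = 𝒜.frac (indicator (S.erase i)) := by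
  have h : indicator S = indicator (S.erase i) + Pi.single i 1 := by
    ext j
    by_cases hj : j = i
    · subst hj
      simp [indicator, hi]
    · simp [indicator, hj]
  rw [h, 𝒜.form_mul_frac_add]

omit [IsScalarTower K (MvPolynomial (Fin n) K) L] [IsScalarTower K (Weyl K n) L] in
lemma form_mul_frac (m : ι → ℕ) {i : ι} (hi : m i ≠ 0) :
    𝒜.form i * 𝒜.frac m = 𝒜.frac (m - Pi.single i 1) := by
  have h : m - Pi.single i 1 + Pi.single i 1 = m := by
    refine tsub_add_cancel_of_le fun j => ?_
    by_cases hj : j = i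
    · subst hj
      simpa [Nat.one_le_iff_ne_zero] using hi
    · simp [hj]
  conv_lhs => rw [← h]
  exact 𝒜.form_mul_frac_add _ i

lemma frac_mem_of_indep [CharZero K] {S : Finset ι} (hS : 𝒜.Indep S) (m : ι → ℕ)
    (hm : ∀ i, m i ≠ 0 ↔ i ∈ S) {W : Submodule (Weyl K n) L} (hW : 𝒜.frac (indicator S) ∈ W) :
    𝒜.frac m ∈ W := by
  obtain ⟨-, -, h⟩ := 𝒜.exists_system hS
  induction hN : ∑ i, m i using Nat.strong_induction_on generalizing m with
  | _ N ih =>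
  by_cases hle : ∀ i, m i ≤ 1
  · have : m = indicator S := by
      ext i
      have h1 := hle i
      have h2 := hm i
      unfold indicator
      split_ifs with hi
      · have := h2.2 hi
        omega
      · by_contra h0
        exact hi (h2.1 h0)
    rwa [this]
  · push Not at hle
    obtain ⟨i, hi⟩ := hle
    obtain ⟨w, D, hw, h1, h2⟩ := h i ((hm i).1 (by omega))
    let m' : ι → ℕ := Function.update m i (m i - 1)
    have hmm : m' + Pi.single i 1 = m := by
      ext j
      by_cases hj : j = i
      · subst hj
        simp [m']
        omega
      · simp [m', hj]
    have hsum : ∑ j, m j = ∑ j, m' j + 1 := by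
      rw [← hmm]
      simp [Finset.sum_add_distrib]
    have hmem : 𝒜.frac m' ∈ W := by
      refine ih _ (by omega) m' (fun j => ?_) rfl
      rw [← hm]
      by_cases hj : j = i
      · subst hj
        simp [m']
        omega
      · simp [m', hj]
    have hact : w • 𝒜.frac m' = (-(m' i : K)) • 𝒜.frac m := by
      rw [hw, 𝒜.derivation_frac, Finset.sum_eq_single i, h1, mul_one, neg_mul, mul_assoc,
        𝒜.inv_mul_frac, hmm, neg_smul, Nat.cast_smul_eq_nsmul, nsmul_eq_mul]
      · intro j _ hj
        by_cases hjS : j ∈ S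
        · rw [h2 j hjS hj, mul_zero, mul_zero]
        · have : m' j = 0 := by
            simp only [m', Function.update_of_ne hj]
            by_contra h0
            exact hjS ((hm j).1 h0)
          simp [this]
      · simp
    have hne : (-(m' i : K)) ≠ 0 := by
      simp only [m', Function.update_self, neg_ne_zero, Nat.cast_ne_zero]
      omega
    rw [← inv_smul_smul₀ hne (𝒜.frac m), ← hact]
    exact W.smul_of_tower_mem _ (W.smul_mem w hmem)

lemma frac_mem_of_not_indep {T : Finset ι} (hT : ¬ 𝒜.Indep T) {W : Submodule (Weyl K n) L}
    (hW : ∀ m : ι → ℕ, (∀ i, m i ≠ 0 → i ∈ T) → (∃ i ∈ T, m i = 0) → 𝒜.frac m ∈ W) (m : ι → ℕ)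
    (hm : ∀ i, m i ≠ 0 → i ∈ T) : 𝒜.frac m ∈ W := by
  obtain ⟨t, c, hrel, i₀, hi₀, ht⟩ := 𝒜.exists_relation hT
  by_cases hc : c = 0
  · induction hN : ∑ i ∈ T.erase i₀, m i using Nat.strong_induction_on generalizing m with
    | _ N ih =>
    by_cases hz : ∃ i ∈ T, m i = 0
    · exact hW m hm hz
    push Not at hz
    have h1 : t i₀ • 𝒜.frac m =
        -∑ i ∈ T.erase i₀, t i • 𝒜.frac (m + Pi.single i₀ 1 - Pi.single i 1) := by
      rw [← Finset.add_sum_erase T _ hi₀, hc, zero_smul] at hrel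
      have h2 := congrArg (· * 𝒜.frac (m + Pi.single i₀ 1)) (eq_neg_of_add_eq_zero_left hrel)
      simp only [smul_mul_assoc, form_mul_frac_add, neg_mul, Finset.sum_mul] at h2
      rw [h2]
      refine congrArg _ (Finset.sum_congr rfl fun i hi => ?_)
      rw [𝒜.form_mul_frac]
      have := hz i (Finset.mem_of_mem_erase hi)
      simp [this]
    rw [← inv_smul_smul₀ ht (𝒜.frac m), h1]
    refine W.smul_of_tower_mem _ (neg_mem (sum_mem fun i hi => W.smul_of_tower_mem _ ?_))
    have hii : i ≠ i₀ := Finset.ne_of_mem_erase hi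
    refine ih _ ?_ _ (fun j hj => ?_) rfl
    · rw [← hN]
      refine Finset.sum_lt_sum (fun j hj => ?_) ⟨i, hi, ?_⟩
      · simp [Finset.ne_of_mem_erase hj]
      · have := hz i (Finset.mem_of_mem_erase hi)
        simp [hii]
        omega
    · by_cases hji : j = i₀
      · rwa [hji]
      · refine hm j fun h0 => hj ?_
        simp [hji, h0]
  · induction hN : ∑ i ∈ T, m i using Nat.strong_induction_on generalizing m with
    | _ N ih =>
    by_cases hz : ∃ i ∈ T, m i = 0
    · exact hW m hm hz
    push Not at hz
    have h1 : c • 𝒜.frac m = ∑ i ∈ T, t i • 𝒜.frac (m - Pi.single i 1) := by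
      have h2 := congrArg (· * 𝒜.frac m) hrel
      simp only [smul_mul_assoc, one_mul, Finset.sum_mul] at h2
      rw [← h2]
      exact Finset.sum_congr rfl fun i hi => by rw [𝒜.form_mul_frac _ (hz i hi)]
    rw [← inv_smul_smul₀ hc (𝒜.frac m), h1]
    refine W.smul_of_tower_mem _ (sum_mem fun i hi => W.smul_of_tower_mem _ ?_)
    refine ih _ ?_ _ (fun j hj => hm j fun h0 => hj (by simp [h0])) rfl
    rw [← hN]
    refine Finset.sum_lt_sum (fun j hj => by simp) ⟨i, hi, ?_⟩
    have := hz i hi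
    simp
    omega

lemma frac_mem [CharZero K] {W : Submodule (Weyl K n) L}
    (hW : ∀ S, 𝒜.Indep S → 𝒜.frac (indicator S) ∈ W) (m : ι → ℕ) : 𝒜.frac m ∈ W := by
  induction hd : (Finset.univ.filter (m · ≠ 0)).card using Nat.strong_induction_on
    generalizing m with
  | _ d ih =>
  by_cases hS : 𝒜.Indep (Finset.univ.filter (m · ≠ 0))
  · exact 𝒜.frac_mem_of_indep hS m (by simp) (hW _ hS)
  · refine 𝒜.frac_mem_of_not_indep hS (fun m' h1 h2 => ih _ ?_ m' rfl) m (by simp)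
    rw [← hd]
    refine Finset.card_lt_card ⟨fun i hi => h1 i (by simpa using hi), fun h => ?_⟩
    obtain ⟨i, hi, h0⟩ := h2
    simpa [h0] using h hi

lemma eq_top_of_frac_indicator_mem [CharZero K] {W : Submodule (Weyl K n) L}
    (hW : ∀ S, 𝒜.Indep S → 𝒜.frac (indicator S) ∈ W)
    (hL : ∀ y : L, ∃ (r : MvPolynomial (Fin n) K) (m : ι → ℕ), y = algebraMap _ L r * 𝒜.frac m) :
    W = ⊤ := by
  have h : ∀ (r : MvPolynomial (Fin n) K), ∀ y ∈ W, algebraMap _ L r * y ∈ W := by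
    intro r
    induction r using MvPolynomial.induction_on with
    | C a =>
      intro y hy
      rw [← MvPolynomial.algebraMap_eq, ← IsScalarTower.algebraMap_apply, ← Algebra.smul_def]
      exact W.smul_of_tower_mem a hy
    | add p q hp hq =>
      intro y hy
      rw [map_add, add_mul]
      exact add_mem (hp y hy) (hq y hy)
    | mul_X p i hp =>
      intro y hy
      rw [map_mul, mul_assoc, ← 𝒜.wX_smul]
      exact hp _ (W.smul_mem _ hy)
  refine (Submodule.eq_top_iff').2 fun y => ?_
  obtain ⟨r, m, rfl⟩ := hL y
  exact h r _ (𝒜.frac_mem hW m)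

variable {M : Type} [AddCommGroup M] [Module K M] [Module (Weyl K n) M]

lemma exists_isWeylFlag_span (π : L →ₗ[Weyl K n] M) (𝒯 : Finset (Finset ι))
    (h𝒯 : ∀ S ∈ 𝒯, 𝒜.Indep S) (hcl : ∀ S ∈ 𝒯, ∀ i ∈ S, S.erase i ∈ 𝒯) :
    ∃ r, IsWeylFlag K n r
      (Submodule.span (Weyl K n) ((fun S => π (𝒜.frac (indicator S))) '' (𝒯 : Set (Finset ι)))) := by
  induction hN : 𝒯.card generalizing 𝒯 with
  | zero =>
    rw [Finset.card_eq_zero] at hN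
    subst hN
    exact ⟨0, by simpa using IsWeylFlag.bot⟩
  | succ N ih =>
    have hne : 𝒯.Nonempty := Finset.card_pos.1 (by omega)
    obtain ⟨S, hS, hmax⟩ := Finset.exists_max_image 𝒯 Finset.card hne
    have hcl' : ∀ S' ∈ 𝒯, ∀ i ∈ S', S'.erase i ∈ 𝒯.erase S := by
      intro S' hS' i hi
      refine Finset.mem_erase.2 ⟨?_, hcl S' hS' i hi⟩
      rintro rfl
      exact absurd (hmax S' hS') (not_le.2 (Finset.card_erase_lt_of_mem hi))
    obtain ⟨r, hr⟩ := ih (𝒯.erase S) (fun S' h => h𝒯 S' (Finset.mem_of_mem_erase h))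
      (fun S' h => hcl' S' (Finset.mem_of_mem_erase h)) (by rw [Finset.card_erase_of_mem hS]; omega)
    rw [← Finset.insert_erase hS, Finset.coe_insert, Set.image_insert_eq, Submodule.span_insert,
      sup_comm]
    by_cases hv : π (𝒜.frac (indicator S)) ∈ Submodule.span (Weyl K n)
        ((fun S => π (𝒜.frac (indicator S))) '' ((𝒯.erase S : Finset (Finset ι)) : Set (Finset ι)))
    · refine ⟨r, ?_⟩
      rwa [sup_eq_left.2 ((Submodule.span_singleton_le_iff_mem _ _).2 hv)]
    · obtain ⟨s, hs, -⟩ := 𝒜.exists_system (h𝒯 S hS)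
      refine ⟨r + 1, hr.snoc s hv fun j => ?_⟩
      rw [← map_smul]
      rcases hs j with ⟨i, hi, h⟩ | ⟨D, hD, h⟩
      · rw [h, 𝒜.form_mul_frac_indicator hi]
        exact Submodule.subset_span ⟨_, hcl' S hS i hi, rfl⟩
      · rw [hD, 𝒜.derivation_frac, Finset.sum_eq_zero, neg_zero, zero_mul, map_zero]
        · exact zero_mem _
        · intro i _
          by_cases hi : i ∈ S
          · rw [h i hi, mul_zero, mul_zero]
          · simp [indicator, hi]

theorem exists_isWeylFlag_top [CharZero K] (π : L →ₗ[Weyl K n] M) (hπ : Function.Surjective π)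
    (hL : ∀ y : L, ∃ (r : MvPolynomial (Fin n) K) (m : ι → ℕ), y = algebraMap _ L r * 𝒜.frac m) :
    ∃ r, IsWeylFlag K n r (⊤ : Submodule (Weyl K n) M) := by
  classical
  obtain ⟨r, hr⟩ := 𝒜.exists_isWeylFlag_span π (Finset.univ.filter 𝒜.Indep) (by simp) (by
    intro S hS i _
    simp only [Finset.mem_filter, Finset.mem_univ, true_and] at hS ⊢
    exact hS.comp (fun j : (S.erase i : Finset ι) => (⟨j, Finset.mem_of_mem_erase j.2⟩ : S))
      fun j k h => Subtype.ext (congrArg (fun x : S => (x : ι)) h))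
  have htop : Submodule.span (Weyl K n) ((fun S => 𝒜.frac (indicator S)) ''
      ((Finset.univ.filter 𝒜.Indep : Finset (Finset ι)) : Set (Finset ι))) = ⊤ :=
    𝒜.eq_top_of_frac_indicator_mem
      (fun S hS => Submodule.subset_span ⟨S, by simpa using hS, rfl⟩) hL
  rw [← Function.comp_def π, Set.image_comp, ← Submodule.map_span, htop, Submodule.map_top,
    LinearMap.range_eq_top.2 hπ] at hr
  exact ⟨r, hr⟩

end WeylArrangement

/-- If `f` is a nonzero product of pairwise non-proportional
degree-one polynomials, defining a hyperplane arrangement in `K^n`, then the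
length of `H¹_{(f)}(R)` as a left `D_n`-module equals its multiplicity with
respect to the Bernstein filtration. -/
theorem length_eq_mult_of_arrangement
    (K : Type) [Field K] [CharZero K] (n : ℕ)
    (A : Finset (MvPolynomial (Fin n) K)) (f : MvPolynomial (Fin n) K)
    (hf : f = ∏ p ∈ A, p) (hf0 : f ≠ 0)
    (hdeg : ∀ p ∈ A, p.totalDegree = 1)
    (hprop : ∀ p ∈ A, ∀ q ∈ A, p ≠ q → ∀ c : K, p ≠ c • q)
    [Module (Weyl K n) (Localization.Away f)]
    [IsScalarTower K (Weyl K n) (Localization.Away f)]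
    (hnat : NatActs K n f) :
    ∀ m : ℚ, HasMult K n (H1 K n f) m →
      ∃ ℓ : ℕ, mlength (Weyl K n) (H1 K n f) = ℓ ∧ (ℓ : ℚ) = m := by
  classical
  intro m hm
  have hmap : algebraMap (MvPolynomial (Fin n) K) (Localization.Away f) f =
      ∏ p : A, algebraMap _ _ (p : MvPolynomial (Fin n) K) := by
    rw [← map_prod, Finset.prod_coe_sort A fun p => p, ← hf]
  have hunit : ∀ p : A,
      IsUnit (algebraMap (MvPolynomial (Fin n) K) (Localization.Away f) p) := fun p =>
    isUnit_of_dvd_unit (map_dvd _ (hf ▸ Finset.dvd_prod_of_mem (fun p => p) p.2))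
      (IsLocalization.Away.algebraMap_isUnit f)
  choose δ hδ hδ' using hnat.2
  choose u hu using fun p => (hunit p).exists_right_inv
  let 𝒜 : WeylArrangement K n (Localization.Away f) A :=
    { der := δ
      wX_smul := hnat.1
      wD_smul := hδ
      der_algebraMap := hδ'
      grad := fun p => linearPart p
      const := fun p => MvPolynomial.coeff 0 (p : MvPolynomial (Fin n) K)
      inv := u
      form_mul_inv' := fun p => by
        rw [← eq_affineForm_of_totalDegree_le_one (hdeg p p.2).le, hu] }
  have hL : ∀ y : Localization.Away f, ∃ (r : MvPolynomial (Fin n) K) (e : A → ℕ),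
      y = algebraMap _ _ r * 𝒜.frac e := by
    intro y
    obtain ⟨k, r, hr⟩ := IsLocalization.Away.surj f y
    refine ⟨r, fun _ => k, ?_⟩
    have h1 : algebraMap (MvPolynomial (Fin n) K) (Localization.Away f) f ^ k *
        𝒜.frac (fun _ => k) = 1 := by
      rw [WeylArrangement.frac, Finset.prod_pow, ← mul_pow, hmap, ← Finset.prod_mul_distrib,
        Finset.prod_eq_one fun p _ => hu p, one_pow]
    rw [← hr, mul_assoc, h1, mul_one]
  obtain ⟨r, hr⟩ := 𝒜.exists_isWeylFlag_top (M := H1 K n f) (Submodule.mkQ _)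
    (Submodule.mkQ_surjective _) hL
  exact ⟨r, hr.mlength_eq, (hr.eq_of_hasMult hm).symm⟩
end

section
/- Let A be a hyperplane arrangement in K^n defined by a squarefree product f of linear polynomials, where K has characteristic zero. Then the length of H^1_{(f)}(R) as a left D_n-module equals π(A,1) − 1, where π(A,t) is the Poincaré polynomial of A. Equivalently, the length equals the sum of |μ(X)| over all elements X of the intersection poset L(A) other than the ambient space V = K^n. -/
open Polynomial MvPolynomial

section OperatorLength

variable {K : Type*} [Field K] {ι : Type*} {M : Type*} [AddCommGroup M] [Module K M]

/-- The subspaces of `M` stable under a family of operators `T`. -/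
abbrev StableSubspace (T : ι → Module.End K M) : Type _ :=
  {N : Submodule K M // ∀ i, ∀ x ∈ N, T i x ∈ N}

/-- The length of a vector space equipped with a family of operators: the Krull dimension of its
lattice of stable subspaces. -/
noncomputable def opLength (T : ι → Module.End K M) : WithBot ℕ∞ :=
  Order.krullDim (StableSubspace T)

/-- Submodules over an algebra are the subspaces stable under a generating family. -/
def submoduleOrderIsoStable {A : Type*} [Semiring A] [Algebra K A] [Module A M]
    (hK : ∀ (r : K) (m : M), algebraMap K A r • m = r • m)
    (a : ι → A) (ha : Algebra.adjoin K (Set.range a) = ⊤) (T : ι → Module.End K M)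
    (hT : ∀ i m, T i m = a i • m) : Submodule A M ≃o StableSubspace T where
  toFun N := ⟨{ N with smul_mem' := fun r x hx => by rw [← hK]; exact N.smul_mem _ hx },
    fun i x hx => by rw [hT]; exact N.smul_mem _ hx⟩
  invFun N :=
    { N.1 with
      smul_mem' := by
        intro c x hx
        have hc : c ∈ Algebra.adjoin K (Set.range a) := by rw [ha]; trivial
        induction hc using Algebra.adjoin_induction generalizing x with
        | mem y hy =>
          obtain ⟨i, rfl⟩ := hy
          rw [← hT]; exact N.2 i x hx
        | algebraMap r => rw [hK]; exact N.1.smul_mem r hx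
        | add y z _ _ h1 h2 => rw [add_smul]; exact N.1.add_mem (h1 hx) (h2 hx)
        | mul y z _ _ h1 h2 => rw [mul_smul]; exact h1 (h2 hx) }
  left_inv N := rfl
  right_inv N := rfl
  map_rel_iff' := Iff.rfl

theorem krullDim_submodule_eq_opLength {A : Type*} [Semiring A] [Algebra K A] [Module A M]
    (hK : ∀ (r : K) (m : M), algebraMap K A r • m = r • m) (a : ι → A) (ha : Algebra.adjoin K (Set.range a) = ⊤)
    (T : ι → Module.End K M) (hT : ∀ i m, T i m = a i • m) :
    Order.krullDim (Submodule A M) = opLength T :=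
  Order.krullDim_eq_of_orderIso (submoduleOrderIsoStable hK a ha T hT)

/-- A vector space with operators `T`, seen as a module over the free algebra. -/
def OpModule (_ : ι → Module.End K M) : Type _ := M

namespace OpModule

variable (T : ι → Module.End K M)

instance : AddCommGroup (OpModule T) := inferInstanceAs (AddCommGroup M)

instance : Module K (OpModule T) := inferInstanceAs (Module K M)

noncomputable instance : Module (FreeAlgebra K ι) (OpModule T) :=
  Module.compHom M (FreeAlgebra.lift K T).toRingHom

theorem smul_def (a : FreeAlgebra K ι) (m : OpModule T) :
    a • m = (FreeAlgebra.lift K T a : Module.End K M) m := rfl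

theorem ι_smul (i : ι) (m : OpModule T) : FreeAlgebra.ι K i • m = T i m := by
  rw [smul_def, FreeAlgebra.lift_ι_apply]

theorem algebraMap_smul (r : K) (m : OpModule T) :
    algebraMap K (FreeAlgebra K ι) r • m = r • m := by
  rw [smul_def, AlgHom.commutes]; rfl

theorem coe_length : (Module.length (FreeAlgebra K ι) (OpModule T) : WithBot ℕ∞) = opLength T := by
  rw [Module.coe_length]
  exact krullDim_submodule_eq_opLength (M := OpModule T)
    (algebraMap_smul T) (FreeAlgebra.ι K)
    (FreeAlgebra.adjoin_range_ι K ι) T (fun i m => (ι_smul T i m).symm)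

variable {T} in
/-- A linear map intertwining operators is linear over the free algebra. -/
def lift {M' : Type*} [AddCommGroup M'] [Module K M'] {T' : ι → Module.End K M'} (φ : M →ₗ[K] M')
    (h : ∀ i x, φ (T i x) = T' i (φ x)) : OpModule T →ₗ[FreeAlgebra K ι] OpModule T' where
  toFun := φ
  map_add' := φ.map_add
  map_smul' a x := by
    change φ _ = a • (show OpModule T' from φ x)
    induction a using FreeAlgebra.induction generalizing x with
    | grade0 r =>
      rw [algebraMap_smul, algebraMap_smul]; exact φ.map_smul r x
    | grade1 i => rw [ι_smul, ι_smul]; exact h i x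
    | mul a b ha hb => rw [mul_smul, mul_smul, ha, hb]
    | add a b ha hb => rw [add_smul, add_smul, ← ha, ← hb]; exact φ.map_add _ _

end OpModule

theorem opLength_eq_add {M' M'' : Type*} [AddCommGroup M'] [Module K M'] [AddCommGroup M'']
    [Module K M''] {T : ι → Module.End K M} {T' : ι → Module.End K M'} {T'' : ι → Module.End K M''}
    (φ : M' →ₗ[K] M) (ψ : M →ₗ[K] M'') (hφ : ∀ i x, φ (T' i x) = T i (φ x))
    (hψ : ∀ i x, ψ (T i x) = T'' i (ψ x)) (hinj : Function.Injective φ)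
    (hsurj : Function.Surjective ψ) (hex : Function.Exact φ ψ) :
    opLength T = opLength T' + opLength T'' := by
  rw [← OpModule.coe_length, ← OpModule.coe_length, ← OpModule.coe_length,
    Module.length_eq_add_of_exact (OpModule.lift φ hφ) (OpModule.lift ψ hψ) hinj hsurj hex]
  rfl

theorem opLength_of_subsingleton [Subsingleton M] (T : ι → Module.End K M) : opLength T = 0 := by
  have : Subsingleton (OpModule T) := ‹Subsingleton M›
  rw [← OpModule.coe_length, Module.length_eq_zero]
  rfl

theorem opLength_of_simple [Nontrivial M] (T : ι → Module.End K M)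
    (h : ∀ N : StableSubspace T, N.1 = ⊥ ∨ N.1 = ⊤) : opLength T = 1 := by
  have : Nontrivial (OpModule T) := ‹Nontrivial M›
  have : IsSimpleModule (FreeAlgebra K ι) (OpModule T) :=
    { eq_bot_or_eq_top := fun N => by
        have := h (submoduleOrderIsoStable (M := OpModule T)
          (OpModule.algebraMap_smul T) (FreeAlgebra.ι K)
          (FreeAlgebra.adjoin_range_ι K ι) T (fun i m => (OpModule.ι_smul T i m).symm) N)
        rcases this with h | h
        · exact Or.inl (SetLike.ext fun x => SetLike.ext_iff.1 h x)
        · exact Or.inr (SetLike.ext fun x => SetLike.ext_iff.1 h x) }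
  rw [← OpModule.coe_length, Module.length_eq_one]
  rfl

theorem opLength_congr {κ : Type*} (T : ι → Module.End K M) (T' : κ → Module.End K M)
    (h : ∀ N : Submodule K M, (∀ i, ∀ x ∈ N, T i x ∈ N) ↔ ∀ i, ∀ x ∈ N, T' i x ∈ N) :
    opLength T = opLength T' :=
  Order.krullDim_eq_of_orderIso
    { toEquiv := Equiv.subtypeEquivRight h
      map_rel_iff' := Iff.rfl }

end OperatorLength

section Kashiwara

variable {K : Type*} [Field K] {ι : Type*} {M : Type*} [AddCommGroup M] [Module K M]

theorem derivation_comp_pow {t d : Module.End K M} (htd : ∀ x, d (t x) = t (d x) + x) (k : ℕ)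
    (x : M) : d ((t ^ k) x) = (t ^ k) (d x) + (k : K) • (t ^ (k - 1)) x := by
  induction k with
  | zero => simp
  | succ k ih =>
    rw [pow_succ', Module.End.mul_apply, htd, ih, map_add, map_smul, Module.End.mul_apply]
    rcases k with _ | k
    · simp
    · have h : t ((t ^ k) x) = (t ^ (k + 1)) x := by rw [pow_succ', Module.End.mul_apply]
      simp only [Nat.add_sub_cancel, h]
      push_cast
      module

theorem euler_pow_apply {t d : Module.End K M} (htd : ∀ x, d (t x) = t (d x) + x) (k : ℕ)
    {x : M} (hx : t x = 0) : t (d ((d ^ k) x)) = -((k : K) + 1) • (d ^ k) x := by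
  induction k with
  | zero =>
    have := htd x
    rw [hx, map_zero] at this
    simp only [pow_zero, Module.End.one_apply, Nat.cast_zero, zero_add, neg_smul, one_smul]
    exact eq_neg_of_add_eq_zero_left this.symm
  | succ k ih =>
    have := htd (d ((d ^ k) x))
    rw [ih, map_smul] at this
    rw [pow_succ', Module.End.mul_apply, eq_sub_of_add_eq this.symm]
    push_cast
    module

/-- The subspace `∑_{i < k} d^i P`. -/
def derivedSpan (d : Module.End K M) (P : Submodule K M) : ℕ → Submodule K M
  | 0 => ⊥
  | k + 1 => derivedSpan d P k ⊔ P.map (d ^ k)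

theorem derivedSpan_monotone (d : Module.End K M) (P : Submodule K M) :
    Monotone (derivedSpan d P) :=
  monotone_nat_of_le_succ fun _ => le_sup_left

theorem derivedSpan_mono (d : Module.End K M) {P Q : Submodule K M} (h : P ≤ Q) (k : ℕ) :
    derivedSpan d P k ≤ derivedSpan d Q k := by
  induction k with
  | zero => exact le_rfl
  | succ k ih => exact sup_le_sup ih (Submodule.map_mono h)

/-- A property of the generators `d^i p` with `i < k` extends to `derivedSpan d P k`. -/
theorem derivedSpan_le {d : Module.End K M} {P Q : Submodule K M} {k : ℕ}
    (h : ∀ i < k, ∀ p ∈ P, (d ^ i) p ∈ Q) : derivedSpan d P k ≤ Q := by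
  induction k with
  | zero => exact bot_le
  | succ k ih =>
    refine sup_le (ih fun i hi => h i (hi.trans k.lt_succ_self)) ?_
    rintro _ ⟨p, hp, rfl⟩
    exact h k k.lt_succ_self p hp

theorem pow_mem_derivedSpan (d : Module.End K M) {P : Submodule K M} {i k : ℕ} (hik : i < k)
    {p : M} (hp : p ∈ P) : (d ^ i) p ∈ derivedSpan d P k :=
  derivedSpan_monotone d P hik (Submodule.mem_sup_right ⟨p, hp, rfl⟩)

theorem mem_of_mem_derivedSpan [CharZero K] {t d : Module.End K M}
    (htd : ∀ x, d (t x) = t (d x) + x) {P : Submodule K M} (hP : ∀ x ∈ P, t x = 0) {k : ℕ} {m : M}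
    (hm : m ∈ derivedSpan d P k) (ht : t m = 0) : m ∈ P := by
  induction k with
  | zero => rw [(Submodule.mem_bot K).1 hm]; exact P.zero_mem
  | succ k ih =>
    obtain ⟨m', hm', _, ⟨q, hq, rfl⟩, rfl⟩ := Submodule.mem_sup.1 hm
    rcases Nat.eq_zero_or_pos k with rfl | hk
    · rw [(Submodule.mem_bot K).1 hm', zero_add]
      simpa using hq
    · refine ih ?_
      have hE : derivedSpan d P k ≤ (derivedSpan d P k).comap (t * d) := by
        refine derivedSpan_le fun i hi p hp => ?_
        rw [Submodule.mem_comap, Module.End.mul_apply, euler_pow_apply htd i (hP p hp)]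
        exact Submodule.smul_mem _ _ (pow_mem_derivedSpan d hi hp)
      have h1 : t (d (m' + (d ^ k) q)) = -(m' + (d ^ k) q) := by
        have := htd (m' + (d ^ k) q)
        rw [ht, map_zero] at this
        exact eq_neg_of_add_eq_zero_left this.symm
      have h2 : (k : K) • (m' + (d ^ k) q) = t (d m') + ((k : K) + 1) • m' := by
        rw [map_add, map_add, euler_pow_apply htd k (hP q hq)] at h1
        have h3 : t (d m') = -(m' + (d ^ k) q) + ((k : K) + 1) • (d ^ k) q := by
          rw [← h1]; module
        rw [h3]; module
      have h3 : (k : K) • (m' + (d ^ k) q) ∈ derivedSpan d P k := by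
        rw [h2]
        exact Submodule.add_mem _ (hE hm') (Submodule.smul_mem _ _ hm')
      exact (Submodule.smul_mem_iff _ (Nat.cast_ne_zero.2 hk.ne')).1 h3

/-- Kashiwara's equivalence at the level of lengths: if `t` is locally nilpotent, `[d, t] = 1` and
the other operators commute with `d`, then the length of `M` is that of `ker t`. -/
theorem opLength_eq_ker [CharZero K] {E : Type*} [AddCommGroup E] [Module K E]
    {t d : Module.End K M} (htd : ∀ x, d (t x) = t (d x) + x)
    (hnil : ∀ x, ∃ k : ℕ, (t ^ k) x = 0) (S : ι → Module.End K M)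
    (hSd : ∀ i x, S i (d x) = d (S i x))
    (e : E →ₗ[K] M) (he : Function.Injective e) (hker : ∀ x, t x = 0 ↔ ∃ y, e y = x)
    (S' : ι → Module.End K E) (heS : ∀ i y, e (S' i y) = S i (e y)) :
    opLength (fun i : Option (Option ι) => i.elim t fun j => j.elim d S) = opLength S' := by
  apply le_antisymm
  · refine Order.krullDim_le_of_strictMono
      (fun N => ⟨N.1.comap e, fun i y hy => ?_⟩) ?_
    · rw [Submodule.mem_comap, heS]
      exact N.2 (some (some i)) _ hy
    · intro N₁ N₂ hlt
      refine lt_of_le_of_ne (Submodule.comap_mono hlt.le) fun heq => hlt.not_ge ?_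
      have hcomap : N₁.1.comap e = N₂.1.comap e := congrArg Subtype.val heq
      have key : ∀ k : ℕ, ∀ m ∈ N₂.1, (t ^ k) m = 0 → m ∈ N₁.1 := by
        intro k
        induction k with
        | zero =>
          intro m _ h0
          rw [show m = 0 from h0]
          exact N₁.1.zero_mem
        | succ k ih =>
          intro m hm h0
          rcases Nat.eq_zero_or_pos k with rfl | hk
          · obtain ⟨y, rfl⟩ := (hker m).1 (by simpa using h0)
            have : y ∈ N₂.1.comap e := hm
            rw [← hcomap] at this
            exact this
          · have htm : t m ∈ N₁.1 := ih _ (N₂.2 none m hm) (by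
              rw [← Module.End.mul_apply, ← pow_succ]; exact h0)
            have h1 : t (d m) + ((k : K) + 1) • m ∈ N₁.1 := by
              refine ih _ (N₂.1.add_mem (N₂.2 none _ (N₂.2 (some none) m hm))
                (N₂.1.smul_mem _ hm)) ?_
              have := derivation_comp_pow htd (k + 1) m
              rw [h0, map_zero, Nat.add_sub_cancel] at this
              rw [map_add, map_smul, ← Module.End.mul_apply, ← pow_succ, this]
              push_cast
              rfl
            have h2 : d (t m) ∈ N₁.1 := N₁.2 (some none) _ htm
            rw [htd] at h2
            have h3 := N₁.1.sub_mem h1 h2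
            have h4 : t (d m) + ((k : K) + 1) • m - (t (d m) + m) = (k : K) • m := by module
            rw [h4] at h3
            exact (Submodule.smul_mem_iff _ (Nat.cast_ne_zero.2 hk.ne')).1 h3
      intro m hm
      obtain ⟨k, hk⟩ := hnil m
      exact key k m hm hk
  · have hmem : ∀ (P : Submodule K E) (m : M),
        m ∈ ⨆ k, derivedSpan d (P.map e) k ↔ ∃ k, m ∈ derivedSpan d (P.map e) k := fun P m =>
      Submodule.mem_iSup_of_directed _ (derivedSpan_monotone d _).directed_le
    have hkill : ∀ (P : Submodule K E), ∀ x ∈ P.map e, t x = 0 := by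
      rintro P _ ⟨y, _, rfl⟩
      exact (hker _).2 ⟨y, rfl⟩
    refine Order.krullDim_le_of_strictMono
      (fun P => ⟨⨆ k, derivedSpan d (P.1.map e) k, ?_⟩) ?_
    · intro i x hx
      obtain ⟨k, hk⟩ := (hmem _ _).1 hx
      refine (hmem _ _).2 ⟨k + 1, ?_⟩
      rcases i with _ | _ | i
      · refine (derivedSpan_le (Q := (derivedSpan d (P.1.map e) (k + 1)).comap t)
          fun i hi p hp => ?_) hk
        rw [Submodule.mem_comap]
        rcases i with _ | i
        · rw [pow_zero, Module.End.one_apply, hkill P.1 p hp]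
          exact Submodule.zero_mem _
        · rw [pow_succ', Module.End.mul_apply, euler_pow_apply htd i (hkill P.1 p hp)]
          exact Submodule.smul_mem _ _ (pow_mem_derivedSpan d (by omega) hp)
      · refine (derivedSpan_le (Q := (derivedSpan d (P.1.map e) (k + 1)).comap d)
          fun i hi p hp => ?_) hk
        rw [Submodule.mem_comap, ← Module.End.mul_apply, ← pow_succ']
        exact pow_mem_derivedSpan d (by omega) hp
      · refine (derivedSpan_le (Q := (derivedSpan d (P.1.map e) (k + 1)).comap (S i))
          fun j hj p hp => ?_) hk
        obtain ⟨y, hy, rfl⟩ := hp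
        have hcomm : ∀ x, S i ((d ^ j) x) = (d ^ j) (S i x) := by
          intro x
          have : Commute (S i) d := LinearMap.ext fun x => hSd i x
          exact LinearMap.congr_fun (this.pow_right j).eq x
        rw [Submodule.mem_comap, hcomm, ← heS]
        exact pow_mem_derivedSpan d (by omega) ⟨_, P.2 i y hy, rfl⟩
    · intro P₁ P₂ hlt
      refine lt_of_le_of_ne
        (iSup_mono fun k => derivedSpan_mono d (Submodule.map_mono hlt.le) k) fun heq =>
          hlt.not_ge ?_
      have heq' : ⨆ k, derivedSpan d (P₁.1.map e) k = ⨆ k, derivedSpan d (P₂.1.map e) k :=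
        congrArg Subtype.val heq
      intro y hy
      have h1 : e y ∈ ⨆ k, derivedSpan d (P₂.1.map e) k :=
        (hmem _ _).2 ⟨1, pow_mem_derivedSpan d (i := 0) one_pos ⟨y, hy, rfl⟩⟩
      rw [← heq'] at h1
      obtain ⟨k, hk⟩ := (hmem _ _).1 h1
      obtain ⟨z, hz, hzy⟩ :=
        mem_of_mem_derivedSpan htd (hkill P₁.1) hk ((hker _).2 ⟨y, rfl⟩)
      exact he hzy ▸ hz

end Kashiwara

section LocalizationDerivation

variable {K R L : Type*} [CommRing K] [CommRing R] [CommRing L] [Algebra K L]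
  [Algebra R L]

/-- A derivation extends to any localization. -/
theorem exists_derivation_extending [Algebra K R] [IsScalarTower K R L] (W : Submonoid R) [IsLocalization W L]
    (D : Derivation K R R) :
    ∃ D' : Derivation K L L, ∀ r, D' (algebraMap R L r) = algebraMap R L (D r) := by
  let φ : R →ₐ[K] TrivSqZeroExt L L :=
    AlgHom.ofLinearMap
      { toFun := fun r => (algebraMap R L r, algebraMap R L (D r))
        map_add' := fun x y => by simp only [map_add]; rfl
        map_smul' := fun k x => by
          simp only [Derivation.map_smul, Algebra.algebraMap_eq_smul_one, smul_assoc]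
          rfl }
      (by
        refine TrivSqZeroExt.ext (map_one _) ?_
        change algebraMap R L (D 1) = 0
        simp)
      (fun x y => by
        refine TrivSqZeroExt.ext (map_mul _ _ _) ?_
        change algebraMap R L (D (x * y)) =
          algebraMap R L x • algebraMap R L (D y) +
            MulOpposite.op (algebraMap R L y) • algebraMap R L (D x)
        simp [mul_comm])
  have hφ : ∀ y : W, IsUnit (φ y) := fun y => by
    rw [TrivSqZeroExt.isUnit_iff_isUnit_fst]
    exact IsLocalization.map_units L y
  let Φ : L →ₐ[K] TrivSqZeroExt L L := IsLocalization.liftAlgHom (M := W) hφ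
  have hΦ : ∀ r, Φ (algebraMap R L r) = φ r := fun r => IsLocalization.lift_eq hφ r
  have hfst : ∀ x, (Φ x).fst = x := by
    have : (TrivSqZeroExt.fstHom K L L).comp Φ = AlgHom.id K L :=
      IsLocalization.algHom_ext W (AlgHom.ext fun r => congrArg TrivSqZeroExt.fst (hΦ r))
    exact fun x => DFunLike.congr_fun this x
  refine ⟨Derivation.mk' ((TrivSqZeroExt.sndHom L L).restrictScalars K ∘ₗ Φ.toLinearMap)
    fun a b => ?_, fun r => congrArg TrivSqZeroExt.snd (hΦ r)⟩
  change (Φ (a * b)).snd = a • (Φ b).snd + b • (Φ a).snd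
  rw [map_mul, TrivSqZeroExt.snd_mul, hfst, hfst]
  simp [mul_comm b]

/-- Compatibility of a ring homomorphism with derivations may be checked before localizing. -/
theorem map_derivation_of_isLocalization {L' : Type*} [CommRing L'] [Algebra K L']
    (W : Submonoid R) [IsLocalization W L] (σ : L →+* L') (D : Derivation K L L)
    (D' : Derivation K L' L')
    (h : ∀ r, σ (D (algebraMap R L r)) = D' (σ (algebraMap R L r))) (x : L) :
    σ (D x) = D' (σ x) := by
  obtain ⟨⟨r, s⟩, hs⟩ := IsLocalization.surj W x
  have h1 := h r
  have hu : IsUnit (σ (algebraMap R L s)) := (IsLocalization.map_units L s).map σ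
  rw [← hs] at h1
  simp only [Derivation.leibniz, map_add, map_mul, smul_eq_mul, h] at h1
  refine hu.mul_left_cancel ?_
  linear_combination h1

theorem derivation_comm_of_isLocalization (W : Submonoid R) [IsLocalization W L]
    (D D' : Derivation K L L)
    (h : ∀ r, D (D' (algebraMap R L r)) = D' (D (algebraMap R L r))) (x : L) :
    D (D' x) = D' (D x) := by
  have := map_derivation_of_isLocalization W (RingHom.id L) ⁅D, D'⁆ 0
    (fun r => by simp [Derivation.commutator_apply, h]) x
  simpa [Derivation.commutator_apply, sub_eq_zero] using this

end LocalizationDerivation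

section WeylOperators

variable {K : Type*} [Field K] {m : ℕ} {L : Type*} [CommRing L] [Algebra K L]
  [Algebra (MvPolynomial (Fin m) K) L] [IsScalarTower K (MvPolynomial (Fin m) K) L]

/-- Multiplications by the coordinates together with given derivations. -/
noncomputable def weylOps (d : Fin m → Derivation K L L) : Fin m ⊕ Fin m → Module.End K L :=
  Sum.elim (fun i => LinearMap.mulLeft K (algebraMap (MvPolynomial (Fin m) K) L (X i)))
    fun i => (d i : L →ₗ[K] L)

theorem algebraMap_mul_mem_of_stable {N : Submodule K L}
    (h : ∀ i, ∀ x ∈ N, algebraMap (MvPolynomial (Fin m) K) L (X i) * x ∈ N)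
    (r : MvPolynomial (Fin m) K) {x : L} (hx : x ∈ N) :
    algebraMap (MvPolynomial (Fin m) K) L r * x ∈ N := by
  induction r using MvPolynomial.induction_on generalizing x with
  | C a =>
    rw [← MvPolynomial.algebraMap_eq, ← IsScalarTower.algebraMap_apply, ← Algebra.smul_def]
    exact N.smul_mem a hx
  | add p q hp hq => rw [map_add, add_mul]; exact N.add_mem (hp hx) (hq hx)
  | mul_X p i hp => rw [map_mul, mul_assoc]; exact hp (h i x hx)

theorem totalDegree_pderiv_lt [CharZero K] {p : MvPolynomial (Fin m) K} {i : Fin m}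
    (h : pderiv i p ≠ 0) : (pderiv i p).totalDegree < p.totalDegree := by
  obtain ⟨β, hβ, hβ'⟩ := (pderiv i p).support.exists_mem_eq_sup
    (by simpa using h) fun s => s.sum fun _ e => e
  rw [MvPolynomial.mem_support_iff, MvPolynomial.coeff_pderiv] at hβ
  have := MvPolynomial.le_totalDegree
    (MvPolynomial.mem_support_iff.2 (left_ne_zero_of_mul hβ))
  rw [Finsupp.sum_add_index' (fun _ => rfl) (fun _ _ _ => rfl),
    Finsupp.sum_single_index rfl] at this
  rw [MvPolynomial.totalDegree, hβ']
  omega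

theorem eq_bot_or_eq_top_of_stable [CharZero K] (N : Submodule K (MvPolynomial (Fin m) K))
    (hX : ∀ i, ∀ x ∈ N, X i * x ∈ N) (hd : ∀ i, ∀ x ∈ N, pderiv i x ∈ N) : N = ⊥ ∨ N = ⊤ := by
  refine or_iff_not_imp_left.2 fun hN => ?_
  obtain ⟨p, hp, hp0⟩ := N.exists_mem_ne_zero_of_ne_bot hN
  have h1 : (1 : MvPolynomial (Fin m) K) ∈ N := by
    induction hk : p.totalDegree using Nat.strong_induction_on generalizing p with
    | _ k ih =>
      subst hk
      by_cases h : ∃ i, pderiv i p ≠ 0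
      · obtain ⟨i, hi⟩ := h
        exact ih _ (totalDegree_pderiv_lt hi) _ (hd i p hp) hi rfl
      · push Not at h
        have hC : p = MvPolynomial.C (MvPolynomial.coeff 0 p) := by
          ext α
          rw [MvPolynomial.coeff_C]
          split_ifs with hα
          · rw [hα]
          · obtain ⟨i, hi⟩ := Finsupp.ne_iff.1 (Ne.symm hα)
            have h1 : α - Finsupp.single i 1 + Finsupp.single i 1 = α := by
              refine tsub_add_cancel_of_le ?_
              rw [Finsupp.single_le_iff]
              exact Nat.one_le_iff_ne_zero.2 (by simpa using hi)
            have h2 := congrArg (MvPolynomial.coeff (α - Finsupp.single i 1)) (h i)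
            rw [MvPolynomial.coeff_pderiv, h1, MvPolynomial.coeff_zero] at h2
            refine (mul_eq_zero.1 h2).resolve_right ?_
            exact Nat.cast_add_one_ne_zero _
        have hc : MvPolynomial.coeff 0 p ≠ 0 := fun h0 => hp0 (by rw [hC, h0, map_zero])
        have := N.smul_mem (MvPolynomial.coeff 0 p)⁻¹ hp
        rw [hC, MvPolynomial.smul_eq_C_mul, ← MvPolynomial.C_mul, MvPolynomial.coeff_C] at this
        simpa [hc] using this
  rw [Submodule.eq_top_iff']
  intro x
  simpa using algebraMap_mul_mem_of_stable (L := MvPolynomial (Fin m) K) (N := N) hX x h1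

theorem opLength_weylOps_of_bijective [CharZero K] (d : Fin m → Derivation K L L)
    (hd : ∀ i r, d i (algebraMap (MvPolynomial (Fin m) K) L r) = algebraMap _ L (pderiv i r))
    (hb : Function.Bijective (algebraMap (MvPolynomial (Fin m) K) L)) :
    opLength (weylOps d) = 1 := by
  have : Nontrivial L := hb.1.nontrivial
  let φ := (IsScalarTower.toAlgHom K (MvPolynomial (Fin m) K) L).toLinearMap
  have hφ : Function.Surjective φ := hb.2
  refine opLength_of_simple _ fun N => ?_
  have hN : N.1 = (N.1.comap φ).map φ := (Submodule.map_comap_eq_of_surjective hφ _).symm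
  rcases eq_bot_or_eq_top_of_stable (N.1.comap φ)
    (fun i x hx => by
      change algebraMap (MvPolynomial (Fin m) K) L (MvPolynomial.X i * x) ∈ N.1
      rw [map_mul]
      exact N.2 (Sum.inl i) _ hx)
    (fun i x hx => by
      change algebraMap _ L (pderiv i x) ∈ N.1
      rw [← hd]
      exact N.2 (Sum.inr i) _ hx) with h | h
  · left; rw [hN, h, Submodule.map_bot]
  · right; rw [hN, h, Submodule.map_top, LinearMap.range_eq_top.2 hφ]

end WeylOperators

section Restriction

variable {K : Type*} [Field K]

/-- The polynomial `∑ a_j X_j + b`. -/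
noncomputable def affinePoly {m : ℕ} (a : Fin m → K) (b : K) : MvPolynomial (Fin m) K :=
  ∑ j, MvPolynomial.C (a j) * MvPolynomial.X j + MvPolynomial.C b

theorem pderiv_affinePoly {m : ℕ} (a : Fin m → K) (b : K) (j : Fin m) :
    pderiv j (affinePoly a b) = MvPolynomial.C (a j) := by
  simp [affinePoly, pderiv_X, Pi.single_apply]

variable {m : ℕ} (i : Fin (m + 1)) (a : Fin (m + 1) → K) (b : K)

/-- Solving `∑ a_j X_j + b = 0` for the `i`-th variable. -/
noncomputable def solveVar : MvPolynomial (Fin m) K :=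
  affinePoly (fun l => -(a (i.succAbove l) / a i)) (-(b / a i))

/-- Restriction of polynomials to the hyperplane `∑ a_j X_j + b = 0`. -/
noncomputable def restrictHyp : MvPolynomial (Fin (m + 1)) K →ₐ[K] MvPolynomial (Fin m) K :=
  MvPolynomial.aeval
    (Fin.insertNth (α := fun _ => MvPolynomial (Fin m) K) i (solveVar i a b) MvPolynomial.X)

theorem restrictHyp_X_succAbove (j : Fin m) :
    restrictHyp i a b (MvPolynomial.X (i.succAbove j)) = MvPolynomial.X j := by
  simp [restrictHyp]

theorem restrictHyp_X_self : restrictHyp i a b (MvPolynomial.X i) = solveVar i a b := by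
  simp [restrictHyp]

variable {i a}

theorem restrictHyp_affinePoly (hi : a i ≠ 0) : restrictHyp i a b (affinePoly a b) = 0 := by
  have h : ∀ c : K, MvPolynomial.C (σ := Fin m) (a i) * MvPolynomial.C (-(c / a i)) = -MvPolynomial.C c := by
    intro c
    rw [← MvPolynomial.C_mul, ← MvPolynomial.C_neg]
    congr 1
    field_simp
  rw [affinePoly, Fin.sum_univ_succAbove _ i]
  simp only [map_add, map_mul, map_sum, restrictHyp_X_succAbove, restrictHyp_X_self]
  simp only [solveVar, affinePoly, MvPolynomial.algHom_C, MvPolynomial.algebraMap_eq, mul_add,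
    Finset.mul_sum, ← mul_assoc, h]
  simp

theorem restrictHyp_surjective : Function.Surjective (restrictHyp i a b) := fun r =>
  ⟨MvPolynomial.aeval (fun j => MvPolynomial.X (i.succAbove j)) r, by
    have : (restrictHyp i a b).comp (MvPolynomial.aeval fun j => MvPolynomial.X (i.succAbove j)) =
        AlgHom.id K _ := MvPolynomial.algHom_ext fun j => by simp [restrictHyp_X_succAbove]
    exact DFunLike.congr_fun this r⟩

theorem affinePoly_dvd_of_restrictHyp_eq_zero (hi : a i ≠ 0) {r : MvPolynomial (Fin (m + 1)) K}
    (hr : restrictHyp i a b r = 0) : affinePoly a b ∣ r := by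
  let I := Ideal.span {affinePoly a b}
  let φ : MvPolynomial (Fin (m + 1)) K →ₐ[K] MvPolynomial (Fin (m + 1)) K ⧸ I :=
    Ideal.Quotient.mkₐ K I
  let φ' := (φ.comp (MvPolynomial.aeval fun j => MvPolynomial.X (i.succAbove j))).comp
    (restrictHyp i a b)
  have h1 : ∀ j, φ' (MvPolynomial.X (i.succAbove j)) = φ (MvPolynomial.X (i.succAbove j)) := by
    intro j
    simp [φ', restrictHyp_X_succAbove]
  have hφ : φ (affinePoly a b) = 0 :=
    Ideal.Quotient.eq_zero_iff_mem.2 (Ideal.mem_span_singleton_self _)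
  have hφ' : φ' (affinePoly a b) = 0 := by
    simp [φ', restrictHyp_affinePoly b hi]
  have h2 : φ' (MvPolynomial.X i) = φ (MvPolynomial.X i) := by
    have h3 := hφ'.trans hφ.symm
    rw [affinePoly, Fin.sum_univ_succAbove _ i] at h3
    simp only [map_add, map_mul, map_sum, h1, MvPolynomial.algHom_C] at h3
    have h4 := add_right_cancel (add_right_cancel h3)
    rw [← Algebra.smul_def, ← Algebra.smul_def] at h4
    have := congrArg ((a i)⁻¹ • ·) h4
    simpa [smul_smul, hi] using this
  have h : φ' = φ := MvPolynomial.algHom_ext fun k => by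
    rcases Fin.eq_self_or_eq_succAbove i k with rfl | ⟨j, rfl⟩
    exacts [h2, h1 j]
  have h0 : φ r = 0 := by rw [← h]; simp [φ', hr]
  exact Ideal.mem_span_singleton.1 (Ideal.Quotient.eq_zero_iff_mem.1 h0)

theorem restrictHyp_pderiv (j : Fin m) (r : MvPolynomial (Fin (m + 1)) K) :
    restrictHyp i a b (pderiv (i.succAbove j) r - (a (i.succAbove j) / a i) • pderiv i r) =
      pderiv j (restrictHyp i a b r) := by
  induction r using MvPolynomial.induction_on with
  | C c => simp [MvPolynomial.algHom_C, MvPolynomial.algebraMap_eq]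
  | add p q hp hq =>
    rw [map_add (restrictHyp i a b), map_add (pderiv j), ← hp, ← hq, ← map_add]
    congr 1
    simp only [map_add]
    module
  | mul_X p k hp =>
    have hX : restrictHyp i a b (pderiv (i.succAbove j) (MvPolynomial.X k) -
        (a (i.succAbove j) / a i) • pderiv i (MvPolynomial.X k)) =
        pderiv j (restrictHyp i a b (MvPolynomial.X k)) := by
      rcases Fin.eq_self_or_eq_succAbove i k with rfl | ⟨l, rfl⟩
      · rw [restrictHyp_X_self, solveVar, pderiv_affinePoly, pderiv_X_self,
          pderiv_X_of_ne (Fin.succAbove_ne k j).symm]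
        simp [MvPolynomial.smul_eq_C_mul]
      · rw [restrictHyp_X_succAbove, pderiv_X_of_ne (Fin.succAbove_ne i l)]
        by_cases h : l = j
        · subst h
          simp
        · rw [pderiv_X_of_ne h, pderiv_X_of_ne (by simpa using h)]
          simp
    rw [map_mul (restrictHyp i a b), (pderiv j).leibniz, ← hX, ← hp, smul_eq_mul, smul_eq_mul,
      ← map_mul, ← map_mul, ← map_add]
    congr 1
    simp only [Derivation.leibniz, smul_eq_mul, Algebra.smul_def]
    ring

end Restriction

theorem pderiv_pderiv_comm {K : Type*} [CommRing K] {ι : Type*} (i j : ι)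
    (p : MvPolynomial ι K) : pderiv i (pderiv j p) = pderiv j (pderiv i p) := by
  classical
  have h : (⁅pderiv i, pderiv j⁆ : Derivation K (MvPolynomial ι K) (MvPolynomial ι K)) = 0 :=
    MvPolynomial.derivation_ext fun k => by
      rw [Derivation.commutator_apply]
      simp [pderiv_X, Pi.single_apply, apply_ite]
  have := DFunLike.congr_fun h p
  rwa [Derivation.commutator_apply, Derivation.zero_apply, sub_eq_zero] at this

section Split

variable {K : Type*} [Field K] {m : ℕ} {L : Type*} [CommRing L] [Algebra K L]
  [Algebra (MvPolynomial (Fin (m + 1)) K) L] [IsScalarTower K (MvPolynomial (Fin (m + 1)) K) L]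

variable (L) in
/-- The vector fields tangent to the hyperplanes parallel to `∑ a_j X_j = 0`. -/
noncomputable def tangentDer (i : Fin (m + 1)) (a : Fin (m + 1) → K)
    (d : Fin (m + 1) → Derivation K L L) (j : Fin m) : Derivation K L L :=
  d (i.succAbove j) - (a (i.succAbove j) / a i) • d i

theorem tangentDer_apply (i : Fin (m + 1)) (a : Fin (m + 1) → K)
    (d : Fin (m + 1) → Derivation K L L) (j : Fin m) (x : L) :
    tangentDer L i a d j x = d (i.succAbove j) x - (a (i.succAbove j) / a i) • d i x := rfl

/-- The operators of the Weyl algebra in coordinates adapted to the hyperplane `∑ a_j X_j + b = 0`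
that are tangent to it. -/
noncomputable def tangentOps (i : Fin (m + 1)) (a : Fin (m + 1) → K)
    (d : Fin (m + 1) → Derivation K L L) : Fin m ⊕ Fin m → Module.End K L :=
  Sum.elim
    (fun j => LinearMap.mulLeft K
      (algebraMap (MvPolynomial (Fin (m + 1)) K) L (MvPolynomial.X (i.succAbove j))))
    fun j => (tangentDer L i a d j : L →ₗ[K] L)

/-- Generators of the Weyl algebra in coordinates adapted to the hyperplane
`∑ a_j X_j + b = 0`. -/
noncomputable def splitOps (i : Fin (m + 1)) (a : Fin (m + 1) → K) (b : K)
    (d : Fin (m + 1) → Derivation K L L) : Option (Option (Fin m ⊕ Fin m)) → Module.End K L :=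
  fun o => o.elim (LinearMap.mulLeft K (algebraMap _ L (affinePoly a b)))
    fun o => o.elim ((a i)⁻¹ • (d i : L →ₗ[K] L)) (tangentOps i a d)

theorem opLength_splitOps {i : Fin (m + 1)} {a : Fin (m + 1) → K} (hi : a i ≠ 0) (b : K)
    (d : Fin (m + 1) → Derivation K L L) : opLength (weylOps d) = opLength (splitOps i a b d) := by
  refine opLength_congr _ _ fun N => ⟨fun h => ?_, fun h => ?_⟩
  · have hX : ∀ i, ∀ x ∈ N, algebraMap (MvPolynomial (Fin (m + 1)) K) L (MvPolynomial.X i) * x ∈ N :=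
      fun i => h (Sum.inl i)
    have hd : ∀ i, ∀ x ∈ N, d i x ∈ N := fun i => h (Sum.inr i)
    rintro (_ | _ | j | j) x hx
    · exact algebraMap_mul_mem_of_stable hX _ hx
    · exact N.smul_mem _ (hd i x hx)
    · exact hX _ x hx
    · exact N.sub_mem (hd _ x hx) (N.smul_mem _ (hd i x hx))
  · have hq : ∀ x ∈ N, algebraMap _ L (affinePoly a b) * x ∈ N := h none
    have hd : ∀ x ∈ N, (a i)⁻¹ • d i x ∈ N := h (some none)
    have hX : ∀ j, ∀ x ∈ N, algebraMap (MvPolynomial (Fin (m + 1)) K) L (MvPolynomial.X (i.succAbove j)) * x ∈ N :=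
      fun j => h (some (some (Sum.inl j)))
    have hδ : ∀ j, ∀ x ∈ N, d (i.succAbove j) x - (a (i.succAbove j) / a i) • d i x ∈ N :=
      fun j => h (some (some (Sum.inr j)))
    have hdi : ∀ x ∈ N, d i x ∈ N := fun x hx => by
      have := N.smul_mem (a i) (hd x hx)
      rwa [smul_smul, mul_inv_cancel₀ hi, one_smul] at this
    have hC : ∀ c : K, algebraMap (MvPolynomial (Fin (m + 1)) K) L (MvPolynomial.C c) =
        algebraMap K L c := fun c => by
      rw [← MvPolynomial.algebraMap_eq, ← IsScalarTower.algebraMap_apply]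
    rintro (k | k) x hx
    · change algebraMap (MvPolynomial (Fin (m + 1)) K) L (MvPolynomial.X k) * x ∈ N
      rcases Fin.eq_self_or_eq_succAbove i k with rfl | ⟨j, rfl⟩
      · have h1 := hq x hx
        rw [affinePoly, Fin.sum_univ_succAbove _ k] at h1
        simp only [map_add, map_sum, map_mul, hC, add_mul, Finset.sum_mul, mul_assoc] at h1
        simp only [← Algebra.smul_def (R := K) (A := L)] at h1
        have h2 := (N.add_mem_iff_left (N.smul_mem b hx)).1 h1
        have h3 := (N.add_mem_iff_left (N.sum_mem fun j _ => N.smul_mem _ (hX j x hx))).1 h2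
        exact (Submodule.smul_mem_iff _ hi).1 h3
      · exact hX j x hx
    · change d k x ∈ N
      rcases Fin.eq_self_or_eq_succAbove i k with rfl | ⟨j, rfl⟩
      · exact hdi x hx
      · have := N.add_mem (hδ j x hx) (N.smul_mem (a (i.succAbove j) / a i) (hdi x hx))
        simpa using this

end Split

section DeletionRestriction

variable {K : Type*} [Field K] {m : ℕ}
  {L L₁ L₂ : Type*} [CommRing L] [Algebra K L] [Algebra (MvPolynomial (Fin (m + 1)) K) L]
  [IsScalarTower K (MvPolynomial (Fin (m + 1)) K) L]
  [CommRing L₁] [Algebra K L₁] [Algebra (MvPolynomial (Fin (m + 1)) K) L₁]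
  [IsScalarTower K (MvPolynomial (Fin (m + 1)) K) L₁]
  [CommRing L₂] [Algebra K L₂] [Algebra (MvPolynomial (Fin m) K) L₂]
  [IsScalarTower K (MvPolynomial (Fin m) K) L₂]

/-- Deletion-restriction for the length of the localization of a polynomial ring. -/
theorem opLength_deletion_restriction [CharZero K] {i : Fin (m + 1)} {a : Fin (m + 1) → K}
    (hi : a i ≠ 0) (b : K)
    (g : MvPolynomial (Fin (m + 1)) K) [IsLocalization.Away (affinePoly a b * g) L]
    [IsLocalization.Away g L₁] [IsLocalization.Away (restrictHyp i a b g) L₂]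
    (d : Fin (m + 1) → Derivation K L L) (d₁ : Fin (m + 1) → Derivation K L₁ L₁)
    (d₂ : Fin m → Derivation K L₂ L₂)
    (hd : ∀ i r, d i (algebraMap (MvPolynomial (Fin (m + 1)) K) L r) = algebraMap _ L (pderiv i r))
    (hd₁ : ∀ i r, d₁ i (algebraMap (MvPolynomial (Fin (m + 1)) K) L₁ r) =
      algebraMap _ L₁ (pderiv i r))
    (hd₂ : ∀ i r, d₂ i (algebraMap (MvPolynomial (Fin m) K) L₂ r) = algebraMap _ L₂ (pderiv i r)) :
    opLength (weylOps d) = opLength (weylOps d₁) + opLength (weylOps d₂) := by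
  set q := affinePoly a b with hq
  set τ := restrictHyp i a b with hτ
  have hq0 : q ≠ 0 := fun h0 => by
    have := pderiv_affinePoly a b i
    rw [← hq, h0, map_zero] at this
    exact hi (by simpa using this.symm)
  -- the two localization maps
  have hgL : IsUnit (IsScalarTower.toAlgHom K (MvPolynomial (Fin (m + 1)) K) L g) :=
    IsLocalization.Away.isUnit_of_dvd (q * g) (dvd_mul_left _ _)
  obtain ⟨ρ, hρ⟩ : ∃ ρ : L₁ →ₐ[K] L,
      ∀ r, ρ (algebraMap (MvPolynomial (Fin (m + 1)) K) L₁ r) = algebraMap _ L r :=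
    ⟨IsLocalization.Away.liftAlgHom g hgL, fun r => IsLocalization.Away.lift_eq g
      (g := (IsScalarTower.toAlgHom K (MvPolynomial (Fin (m + 1)) K) L).toRingHom) hgL r⟩
  obtain ⟨σ, hσs, hσ⟩ : ∃ σ : L₁ →ₐ[K] L₂, Function.Surjective σ ∧
      ∀ r, σ (algebraMap (MvPolynomial (Fin (m + 1)) K) L₁ r) = algebraMap _ L₂ (τ r) :=
    ⟨IsLocalization.Away.mapₐ L₁ L₂ τ g,
      IsLocalization.Away.mapₐ_surjective_of_surjective g (restrictHyp_surjective b),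
      fun r => IsLocalization.map_eq (M := Submonoid.powers g) (T := Submonoid.powers (τ g))
        (g := τ.toRingHom) (by rintro _ ⟨k, rfl⟩; exact ⟨k, (map_pow τ g k).symm⟩) r⟩
  have hgu : IsUnit (algebraMap (MvPolynomial (Fin (m + 1)) K) L₁ g) := IsLocalization.Away.algebraMap_isUnit g
  have hρi : Function.Injective ρ := by
    rw [injective_iff_map_eq_zero]
    intro x hx
    obtain ⟨k, r, hr⟩ := IsLocalization.Away.surj g x
    have h1 : algebraMap (MvPolynomial (Fin (m + 1)) K) L r = 0 := by rw [← hρ, ← hr, map_mul, hx, zero_mul]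
    obtain ⟨N, hN⟩ := IsLocalization.Away.exists_of_eq (q * g) (h1.trans (map_zero _).symm)
    rw [mul_zero, mul_pow, mul_assoc] at hN
    have h2 := (mul_eq_zero.1 hN).resolve_left (pow_ne_zero _ hq0)
    have h3 := congrArg (algebraMap (MvPolynomial (Fin (m + 1)) K) L₁) h2
    rw [map_mul, map_pow, map_zero, ← hr, ← map_pow] at h3
    rw [map_pow] at h3
    exact ((hgu.pow k).mul_left_eq_zero).1 (((hgu.pow N).mul_right_eq_zero).1 h3)
  have hσker : ∀ x, σ x = 0 → ∃ y, x = algebraMap (MvPolynomial (Fin (m + 1)) K) L₁ q * y := by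
    intro x hx
    obtain ⟨k, r, hr⟩ := IsLocalization.Away.surj g x
    have h1 : algebraMap _ L₂ (τ r) = 0 := by rw [← hσ, ← hr, map_mul, hx, zero_mul]
    obtain ⟨N, hN⟩ := IsLocalization.Away.exists_of_eq (τ g) (h1.trans (map_zero _).symm)
    rw [mul_zero, ← map_pow, ← map_mul] at hN
    obtain ⟨s, hs⟩ := affinePoly_dvd_of_restrictHyp_eq_zero b hi hN
    have h3 := congrArg (algebraMap (MvPolynomial (Fin (m + 1)) K) L₁) hs
    rw [map_mul, ← hr, map_mul, map_pow] at h3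
    obtain ⟨v, hv⟩ := (hgu.pow N).mul (hgu.pow k)
    refine ⟨algebraMap (MvPolynomial (Fin (m + 1)) K) L₁ s * ↑v⁻¹, ?_⟩
    have h4 := v.mul_inv
    rw [hv] at h4
    linear_combination (-x) * h4 + (↑v⁻¹ : L₁) * h3
  have hqu : IsUnit (algebraMap (MvPolynomial (Fin (m + 1)) K) L q) :=
    IsLocalization.Away.isUnit_of_dvd (q * g) (dvd_mul_right _ _)
  obtain ⟨u, hu⟩ := hqu.exists_right_inv
  -- compatibility with derivations
  have hρd : ∀ j x, ρ (d₁ j x) = d j (ρ x) := fun j =>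
    map_derivation_of_isLocalization (Submonoid.powers g) ρ.toRingHom (d₁ j) (d j)
      fun r => by
        change ρ _ = d j (ρ _)
        rw [hd₁, hρ, hρ, hd]
  have hσd : ∀ j x, σ (tangentDer L₁ i a d₁ j x) = d₂ j (σ x) := fun j =>
    map_derivation_of_isLocalization (Submonoid.powers g) σ.toRingHom
      (tangentDer L₁ i a d₁ j) (d₂ j) fun r => by
        change σ (tangentDer L₁ i a d₁ j (algebraMap _ L₁ r)) = d₂ j (σ (algebraMap _ L₁ r))
        rw [tangentDer_apply, hd₁, hd₁, hσ, hd₂, ← restrictHyp_pderiv, ← hτ, ← hσ]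
        simp [Algebra.smul_def, IsScalarTower.algebraMap_apply K (MvPolynomial (Fin (m + 1)) K) L₁]
  have hρU : ∀ o x, ρ (splitOps i a b d₁ o x) = splitOps i a b d o (ρ x) := by
    rintro (_ | _ | j | j) x
    · change ρ (algebraMap _ L₁ q * x) = algebraMap _ L q * ρ x
      rw [map_mul, hρ]
    · change ρ ((a i)⁻¹ • d₁ i x) = (a i)⁻¹ • d i (ρ x)
      rw [map_smul, hρd]
    · change ρ (algebraMap (MvPolynomial (Fin (m + 1)) K) L₁ _ * x) = algebraMap _ L _ * ρ x
      rw [map_mul, hρ]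
    · change ρ (tangentDer L₁ i a d₁ j x) = tangentDer L i a d j (ρ x)
      rw [tangentDer_apply, tangentDer_apply, map_sub, map_smul, hρd, hρd]
  let P : Submodule K L := LinearMap.range ρ.toLinearMap
  have hP : ∀ o, P ≤ P.comap (splitOps i a b d o) := by
    rintro o _ ⟨x, rfl⟩
    exact ⟨splitOps i a b d₁ o x, hρU o x⟩
  let U : Option (Option (Fin m ⊕ Fin m)) → Module.End K (L ⧸ P) := fun o =>
    P.mapQ P (splitOps i a b d o) (hP o)
  have hex : Function.Exact ρ.toLinearMap P.mkQ := fun x => by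
    rw [← LinearMap.mem_ker, Submodule.ker_mkQ]
    rfl
  rw [opLength_splitOps hi b d, opLength_splitOps hi b d₁,
    opLength_eq_add (T'' := U) ρ.toLinearMap P.mkQ hρU (fun _ _ => rfl) hρi P.mkQ_surjective hex]
  congr 1
  have hU : U = fun o => o.elim (U none) fun o => o.elim (U (some none))
      fun j => U (some (some j)) := by
    funext o
    rcases o with _ | _ | o <;> rfl
  let e' : L₁ →ₗ[K] L ⧸ P := P.mkQ ∘ₗ LinearMap.mulLeft K u ∘ₗ ρ.toLinearMap
  have he'0 : ∀ x, e' x = 0 ↔ σ x = 0 := by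
    intro x
    change P.mkQ (u * ρ x) = 0 ↔ _
    rw [← LinearMap.mem_ker, Submodule.ker_mkQ]
    constructor
    · rintro ⟨y, hy⟩
      have h1 : ρ x = ρ (algebraMap _ L₁ q * y) := by
        change ρ y = _ at hy
        rw [map_mul, hρ, hy]
        linear_combination (-ρ x) * hu
      rw [hρi h1, map_mul, hσ, hτ, hq, restrictHyp_affinePoly b hi, map_zero, zero_mul]
    · intro hx
      obtain ⟨y, rfl⟩ := hσker x hx
      refine ⟨y, ?_⟩
      change ρ y = _
      rw [map_mul, hρ]
      linear_combination (-ρ y) * hu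
  have hσl : Function.Surjective σ.toLinearMap := hσs
  obtain ⟨sec, hsec⟩ := σ.toLinearMap.exists_rightInverse_of_surjective
    (LinearMap.range_eq_top.2 hσl)
  let e : L₂ →ₗ[K] L ⧸ P := e' ∘ₗ sec
  have heσ : ∀ x, e (σ x) = e' x := by
    intro x
    rw [← sub_eq_zero]
    change e' (sec (σ x)) - e' x = 0
    rw [← map_sub, he'0, map_sub, sub_eq_zero]
    exact LinearMap.congr_fun hsec (σ x)
  have hdq : ∀ j, d j (algebraMap _ L q) = algebraMap _ L (MvPolynomial.C (a j)) := fun j => by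
    rw [hd, hq, pderiv_affinePoly]
  have hC : ∀ c : K, algebraMap (MvPolynomial (Fin (m + 1)) K) L (MvPolynomial.C c) =
      algebraMap K L c := fun c => by
    rw [← MvPolynomial.algebraMap_eq, ← IsScalarTower.algebraMap_apply]
  have hdd : ∀ j k x, d j (d k x) = d k (d j x) := fun j k =>
    derivation_comm_of_isLocalization (Submonoid.powers (q * g)) (d j) (d k) fun r => by
      rw [hd, hd, hd, hd, pderiv_pderiv_comm]
  rw [hU]
  refine opLength_eq_ker ?_ ?_ _ ?_ e ?_ ?_ (weylOps d₂) ?_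
  · intro x
    induction x using Submodule.Quotient.induction_on with | _ x
    change P.mkQ ((a i)⁻¹ • d i (algebraMap _ L q * x)) =
      P.mkQ (algebraMap _ L q * (a i)⁻¹ • d i x + x)
    congr 1
    rw [Derivation.leibniz, hdq, hC, smul_add, smul_eq_mul, smul_eq_mul, mul_comm x,
      ← Algebra.smul_def (R := K) (A := L), smul_smul, inv_mul_cancel₀ hi, one_smul, mul_smul_comm]
  · intro x
    induction x using Submodule.Quotient.induction_on with | _ x
    obtain ⟨k, r, hr⟩ := IsLocalization.Away.surj (q * g) x
    have hk : ∀ k y, (U none ^ k) (P.mkQ y) = P.mkQ (algebraMap _ L q ^ k * y) := by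
      intro k
      induction k with
      | zero => intro y; simp
      | succ k ih =>
        intro y
        rw [pow_succ, Module.End.mul_apply, pow_succ, mul_assoc, ← ih]
        rfl
    refine ⟨k, (hk k x).trans ?_⟩
    rw [← LinearMap.mem_ker, Submodule.ker_mkQ]
    obtain ⟨v, hv⟩ := hgu.pow k
    refine ⟨algebraMap _ L₁ r * ↑v⁻¹, ?_⟩
    change ρ _ = _
    have h4 := congrArg ρ (v.mul_inv)
    rw [hv, map_mul, map_pow, hρ, map_one] at h4
    rw [map_mul, hρ, ← hr, map_mul, mul_pow]
    linear_combination (x * algebraMap _ L q ^ k) * h4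
  · intro o x
    induction x using Submodule.Quotient.induction_on with | _ x
    rcases o with j | j
    · change P.mkQ (algebraMap _ L _ * (a i)⁻¹ • d i x) =
        P.mkQ ((a i)⁻¹ • d i (algebraMap _ L (MvPolynomial.X (i.succAbove j)) * x))
      rw [Derivation.leibniz, hd, pderiv_X_of_ne (Fin.succAbove_ne i j)]
      simp
    · change P.mkQ (tangentDer L i a d j ((a i)⁻¹ • d i x)) =
        P.mkQ ((a i)⁻¹ • d i (tangentDer L i a d j x))
      congr 1
      simp only [tangentDer_apply, Derivation.map_smul, map_sub, hdd (i.succAbove j) i]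
  · rw [← LinearMap.ker_eq_bot, LinearMap.ker_eq_bot']
    intro y hy
    obtain ⟨x, rfl⟩ := hσs y
    rw [heσ] at hy
    exact (he'0 x).1 hy
  · intro x
    induction x using Submodule.Quotient.induction_on with | _ x
    constructor
    · intro hx
      change P.mkQ (algebraMap _ L q * x) = 0 at hx
      rw [← LinearMap.mem_ker, Submodule.ker_mkQ] at hx
      obtain ⟨y, hy⟩ := hx
      change ρ y = _ at hy
      refine ⟨σ y, ?_⟩
      rw [heσ]
      change P.mkQ (u * ρ y) = P.mkQ x
      rw [hy]
      congr 1
      linear_combination x * hu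
    · rintro ⟨y, hy⟩
      obtain ⟨z, rfl⟩ := hσs y
      rw [heσ] at hy
      rw [← hy]
      change P.mkQ (algebraMap _ L q * (u * ρ z)) = 0
      rw [← LinearMap.mem_ker, Submodule.ker_mkQ]
      refine ⟨z, ?_⟩
      change ρ z = _
      linear_combination (-ρ z) * hu
  · intro o y
    obtain ⟨x, rfl⟩ := hσs y
    rw [heσ]
    rcases o with j | j
    · change e (algebraMap _ L₂ (MvPolynomial.X j) * σ x) =
        P.mkQ (algebraMap _ L (MvPolynomial.X (i.succAbove j)) * (u * ρ x))
      rw [← restrictHyp_X_succAbove i a b j, ← hτ, ← hσ, ← map_mul, heσ]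
      change P.mkQ (u * ρ _) = _
      rw [map_mul ρ, hρ, mul_left_comm]
    · change e (d₂ j (σ x)) = P.mkQ (tangentDer L i a d j (u * ρ x))
      rw [← hσd, heσ]
      change P.mkQ (u * ρ _) = _
      have h1 : tangentDer L i a d j (algebraMap _ L q) = 0 := by
        rw [tangentDer_apply, hdq, hdq, hC, hC, Algebra.smul_def, ← map_mul,
          div_mul_cancel₀ _ hi, sub_self]
      have h2 : tangentDer L i a d j u = 0 := by
        have := congrArg (tangentDer L i a d j) hu
        rw [Derivation.leibniz, h1, Derivation.map_one_eq_zero, smul_zero, add_zero,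
          smul_eq_mul] at this
        exact (hqu.mul_right_eq_zero).1 this
      have h3 : ρ (tangentDer L₁ i a d₁ j x) = tangentDer L i a d j (ρ x) := by
        rw [tangentDer_apply, tangentDer_apply, map_sub, map_smul, hρd, hρd]
      rw [Derivation.leibniz, h2, smul_zero, add_zero, h3, smul_eq_mul]

end DeletionRestriction

section Whitney

variable (K : Type*) [Field K] {V : Type*} [AddCommGroup V] [Module K V] {ι : Type*}

/-- The signed sum, over all subfamilies `S` of a family of sets, of a weight of the intersection
of `S` with `X`. -/
noncomputable def whitneySum (Z : ι → Set V) (s : Finset ι) (w : Set V → ℤ) (X : Set V) : ℤ :=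
  ∑ S ∈ s.powerset, (-1) ^ (S.card + Module.finrank K (vectorSpan K X)) * w (X ∩ ⋂ i ∈ S, Z i)

variable {K} {Z : ι → Set V} {s : Finset ι} {w : Set V → ℤ} {X : Set V} {p : ι}

theorem whitneySum_empty :
    whitneySum K Z ∅ w X = (-1) ^ Module.finrank K (vectorSpan K X) * w X := by
  simp [whitneySum]

variable [DecidableEq ι]

theorem whitneySum_insert (hp : p ∉ s) :
    whitneySum K Z (insert p s) w X = whitneySum K Z s w X -
      ∑ S ∈ s.powerset, (-1) ^ (S.card + Module.finrank K (vectorSpan K X)) *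
        w ((X ∩ Z p) ∩ ⋂ i ∈ S, Z i) := by
  rw [whitneySum, Finset.sum_powerset_insert hp, whitneySum, sub_eq_add_neg,
    ← Finset.sum_neg_distrib]
  congr 1
  refine Finset.sum_congr rfl fun S hS => ?_
  rw [Finset.card_insert_of_notMem fun h => hp (Finset.mem_powerset.1 hS h),
    Finset.set_biInter_insert, ← Set.inter_assoc, add_right_comm, pow_succ]
  ring

theorem whitneySum_insert_of_subset (hp : p ∉ s) (h : X ⊆ Z p) :
    whitneySum K Z (insert p s) w X = 0 := by
  rw [whitneySum_insert hp, Set.inter_eq_left.2 h]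
  exact sub_self _

theorem whitneySum_insert_of_disjoint (hp : p ∉ s) (hw : w ∅ = 0) (h : X ∩ Z p = ∅) :
    whitneySum K Z (insert p s) w X = whitneySum K Z s w X := by
  simp [whitneySum_insert hp, h, hw]

theorem whitneySum_insert_of_finrank (hp : p ∉ s)
    (h : Module.finrank K (vectorSpan K (X ∩ Z p)) + 1 = Module.finrank K (vectorSpan K X)) :
    whitneySum K Z (insert p s) w X = whitneySum K Z s w X + whitneySum K Z s w (X ∩ Z p) := by
  rw [whitneySum_insert hp, sub_eq_add_neg, whitneySum, whitneySum, ← h, ← Finset.sum_neg_distrib]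
  congr 1
  refine Finset.sum_congr rfl fun S _ => ?_
  rw [← add_assoc, pow_succ]
  ring

/-- The zero locus of an affine function. -/
def affineZeros (h : V →ᵃ[K] K) : AffineSubspace K V :=
  (⊥ : Submodule K K).toAffineSubspace.comap h

theorem coe_affineZeros (h : V →ᵃ[K] K) : (affineZeros h : Set V) = {x | h x = 0} := by
  ext x
  simp [affineZeros]

theorem finrank_vectorSpan_inter_affineZeros [FiniteDimensional K V] {Q : AffineSubspace K V}
    {h : V →ᵃ[K] K} {x y : V} (hx : x ∈ Q) (hx0 : h x = 0) (hy : y ∈ Q) (hy0 : h y ≠ 0) :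
    Module.finrank K (vectorSpan K ((Q : Set V) ∩ affineZeros h)) + 1 =
      Module.finrank K (vectorSpan K (Q : Set V)) := by
  let l : Q.direction →ₗ[K] K := h.linear ∘ₗ Q.direction.subtype
  have hmem : ∀ z, z ∈ affineZeros h ↔ h z = 0 := fun z => by
    rw [← SetLike.mem_coe, coe_affineZeros]; rfl
  have h1 : vectorSpan K ((Q : Set V) ∩ affineZeros h) = (LinearMap.ker l).map Q.direction.subtype := by
    rw [← AffineSubspace.coe_inf]
    change (Q ⊓ affineZeros h).direction = _
    have hxm : x ∈ Q ⊓ affineZeros h := ⟨hx, (hmem x).2 hx0⟩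
    ext v
    rw [← AffineSubspace.vadd_mem_iff_mem_direction v hxm]
    have hv : h (v +ᵥ x) = h.linear v := by
      rw [h.map_vadd, hx0, vadd_eq_add, add_zero]
    rw [AffineSubspace.mem_inf_iff, hmem, hv, AffineSubspace.vadd_mem_iff_mem_direction v hx]
    simp [l, and_comm]
  have hl : Function.Surjective l := by
    refine LinearMap.surjective fun h0 => hy0 ?_
    have := LinearMap.congr_fun h0 ⟨y -ᵥ x, AffineSubspace.vsub_mem_direction hy hx⟩
    change h.linear (y -ᵥ x) = 0 at this
    rwa [h.linearMap_vsub, hx0, vsub_eq_sub, sub_zero] at this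
  have h2 := l.finrank_range_add_finrank_ker
  rw [LinearMap.range_eq_top.2 hl, finrank_top, Module.finrank_self] at h2
  rw [h1, Submodule.finrank_map_subtype_eq, add_comm, h2]
  rfl

theorem whitneySum_nonneg [FiniteDimensional K V] (h : ι → V →ᵃ[K] K) {w : Set V → ℤ}
    (hw : w ∅ = 0) (hw0 : ∀ X : Set V, 0 ≤ (-1) ^ Module.finrank K (vectorSpan K X) * w X)
    (s : Finset ι) (Q : AffineSubspace K V) :
    0 ≤ whitneySum K (fun i => (affineZeros (h i) : Set V)) s w Q := by
  induction s using Finset.induction_on generalizing Q with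
  | empty => rw [whitneySum_empty]; exact hw0 _
  | insert p s hp ih =>
    by_cases h1 : ∀ x ∈ Q, h p x = 0
    · rw [whitneySum_insert_of_subset hp (by rw [coe_affineZeros]; exact h1)]
    · by_cases h2 : ∃ x ∈ Q, h p x = 0
      · obtain ⟨x, hx, hx0⟩ := h2
        push Not at h1
        obtain ⟨y, hy, hy0⟩ := h1
        have key := whitneySum_insert_of_finrank (w := w) (X := (Q : Set V))
          (Z := fun i => (affineZeros (h i) : Set V)) hp
          (finrank_vectorSpan_inter_affineZeros hx hx0 hy hy0)
        have h3 : (Q : Set V) ∩ affineZeros (h p) = ((Q ⊓ affineZeros (h p) : AffineSubspace K V) : Set V) :=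
          (AffineSubspace.coe_inf _ _).symm
        rw [key, h3]
        exact add_nonneg (ih _) (ih _)
      · rw [whitneySum_insert_of_disjoint hp hw]
        · exact ih _
        · rw [coe_affineZeros]
          exact Set.eq_empty_of_forall_notMem fun x hx => h2 ⟨x, hx.1, hx.2⟩

end Whitney

section Induction

variable {K : Type*} [Field K]

theorem eval_affinePoly {m : ℕ} (a : Fin m → K) (b : K) (y : Fin m → K) :
    MvPolynomial.eval y (affinePoly a b) = ∑ j, a j * y j + b := by
  simp [affinePoly]

/-- The polynomial of degree at most one defining an affine function on `K^m`. -/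
noncomputable def AffineMap.toMvPolynomial {m : ℕ} (h : (Fin m → K) →ᵃ[K] K) :
    MvPolynomial (Fin m) K :=
  affinePoly (fun j => h.linear (Pi.single j 1)) (h 0)

theorem AffineMap.eval_toMvPolynomial {m : ℕ} (h : (Fin m → K) →ᵃ[K] K) (y : Fin m → K) :
    MvPolynomial.eval y h.toMvPolynomial = h y := by
  have h1 : ∀ j, Pi.single j (y j) = y j • Pi.single (M := fun _ : Fin m => K) j 1 := fun j => by
    rw [← Pi.single_smul, smul_eq_mul, mul_one]
  have h2 : h.linear y = ∑ j, h.linear (Pi.single j 1) * y j := by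
    conv_lhs => rw [← Finset.univ_sum_single y, map_sum]
    refine Finset.sum_congr rfl fun j _ => ?_
    rw [h1, map_smul, smul_eq_mul, mul_comm]
  rw [toMvPolynomial, eval_affinePoly, ← h2]
  exact (congrFun h.decomp y).symm

/-- The affine function with given coefficients. -/
def affineFunc {m : ℕ} (a : Fin m → K) (b : K) : (Fin m → K) →ᵃ[K] K :=
  (∑ j, a j • LinearMap.proj (R := K) (φ := fun _ : Fin m => K) j).toAffineMap +
    AffineMap.const K _ b

theorem affineFunc_apply {m : ℕ} (a : Fin m → K) (b : K) (y : Fin m → K) :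
    affineFunc a b y = ∑ j, a j * y j + b := by
  simp [affineFunc]

variable {m : ℕ} (i : Fin (m + 1)) (a : Fin (m + 1) → K) (b : K)

/-- The parametrization of the hyperplane `∑ a_j x_j + b = 0` by the coordinates other
than the `i`-th. -/
def hypParam : (Fin m → K) →ᵃ[K] (Fin (m + 1) → K) :=
  AffineMap.pi (Fin.insertNth (α := fun _ => (Fin m → K) →ᵃ[K] K) i
    (affineFunc (fun l => -(a (i.succAbove l) / a i)) (-(b / a i)))
    fun j => (LinearMap.proj (R := K) (φ := fun _ : Fin m => K) j).toAffineMap)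

theorem hypParam_self (y : Fin m → K) :
    hypParam i a b y i = ∑ l, -(a (i.succAbove l) / a i) * y l + -(b / a i) := by
  simp [hypParam, affineFunc_apply]

theorem hypParam_succAbove (y : Fin m → K) (j : Fin m) :
    hypParam i a b y (i.succAbove j) = y j := by
  simp [hypParam]

theorem eval_restrictHyp (y : Fin m → K) (r : MvPolynomial (Fin (m + 1)) K) :
    MvPolynomial.eval y (restrictHyp i a b r) = MvPolynomial.eval (hypParam i a b y) r := by
  have : (MvPolynomial.aeval (R := K) y).comp (restrictHyp i a b) =
      MvPolynomial.aeval (R := K) (hypParam i a b y) := MvPolynomial.algHom_ext fun k => by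
    rcases Fin.eq_self_or_eq_succAbove i k with rfl | ⟨j, rfl⟩
    · simp [restrictHyp_X_self, solveVar, MvPolynomial.aeval_eq_eval, eval_affinePoly,
        hypParam_self]
    · simp [restrictHyp_X_succAbove, hypParam_succAbove]
  have h2 := DFunLike.congr_fun this r
  simpa [MvPolynomial.aeval_eq_eval] using h2

variable {i a}

theorem range_hypParam (hi : a i ≠ 0) :
    Set.range (hypParam i a b) = {x | ∑ j, a j * x j + b = 0} := by
  ext x
  constructor
  · rintro ⟨y, rfl⟩
    rw [Set.mem_ofPred_eq, ← eval_affinePoly, ← eval_restrictHyp, restrictHyp_affinePoly b hi,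
      map_zero]
  · intro hx
    rw [Set.mem_ofPred_eq, Fin.sum_univ_succAbove _ i] at hx
    refine ⟨fun j => x (i.succAbove j), funext fun k => ?_⟩
    rcases Fin.eq_self_or_eq_succAbove i k with rfl | ⟨j, rfl⟩
    · rw [hypParam_self]
      have h1 : ∑ l, -(a (k.succAbove l) / a k) * x (k.succAbove l) =
          -(∑ l, a (k.succAbove l) * x (k.succAbove l)) / a k := by
        rw [neg_div, Finset.sum_div, ← Finset.sum_neg_distrib]
        exact Finset.sum_congr rfl fun l _ => by ring
      rw [h1]
      field_simp
      linear_combination -hx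
    · rw [hypParam_succAbove]


variable (K) in
/-- The dimension sign of a nonempty set, and zero for the empty set. -/
noncomputable def dimSign {V : Type*} [AddCommGroup V] [Module K V] (Y : Set V) : ℤ :=
  open scoped Classical in if Y.Nonempty then (-1) ^ Module.finrank K (vectorSpan K Y) else 0

theorem dimSign_empty {V : Type*} [AddCommGroup V] [Module K V] :
    dimSign K (∅ : Set V) = 0 := by simp [dimSign]

end Induction

section Induction

universe u

variable {K : Type u} [Field K] {V : Type*} [AddCommGroup V] [Module K V]
  [FiniteDimensional K V] {ι : Type*}

theorem exists_derivations_extending {m : ℕ} (L : Type*) [CommRing L] [Algebra K L]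
    [Algebra (MvPolynomial (Fin m) K) L] [IsScalarTower K (MvPolynomial (Fin m) K) L]
    (g : MvPolynomial (Fin m) K) [IsLocalization.Away g L] :
    ∃ d : Fin m → Derivation K L L,
      ∀ i r, d i (algebraMap (MvPolynomial (Fin m) K) L r) = algebraMap _ L (pderiv i r) := by
  choose d hd using fun i => exists_derivation_extending (L := L) (Submonoid.powers g)
    (pderiv (R := K) (σ := Fin m) i)
  exact ⟨d, hd⟩

/-- The length of the localization of a polynomial ring at a product of affine functions is a
signed count of the intersections of their zero loci. -/
theorem opLength_eq_whitneySum [CharZero K] [DecidableEq ι] (h : ι → V →ᵃ[K] K) (s : Finset ι) (m : ℕ)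
    (ψ : (Fin m → K) →ᵃ[K] V) (L : Type u) [CommRing L] [Algebra K L]
    [Algebra (MvPolynomial (Fin m) K) L] [IsScalarTower K (MvPolynomial (Fin m) K) L]
    [IsLocalization.Away (∏ i ∈ s, ((h i).comp ψ).toMvPolynomial) L]
    (d : Fin m → Derivation K L L)
    (hd : ∀ i r, d i (algebraMap (MvPolynomial (Fin m) K) L r) = algebraMap _ L (pderiv i r)) :
    ∃ ℓ : ℕ, opLength (weylOps d) = ℓ ∧
      (ℓ : ℤ) = whitneySum K (fun i => (affineZeros (h i) : Set V)) s (dimSign K)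
        (Set.range ψ) := by
  induction s using Finset.induction_on generalizing m L with
  | empty =>
    have hL : IsLocalization.Away (1 : MvPolynomial (Fin m) K) L := by
      rw [← Finset.prod_empty (f := fun i => ((h i).comp ψ).toMvPolynomial)]; infer_instance
    refine ⟨1, opLength_weylOps_of_bijective d hd ?_, ?_⟩
    · exact (IsLocalization.atOne _ L).bijective
    · rw [whitneySum_empty, dimSign, if_pos (Set.range_nonempty _), ← mul_pow]
      simp
  | insert p s hp ih =>
    set g := ∏ i ∈ s, ((h i).comp ψ).toMvPolynomial with hg
    let q := ((h p).comp ψ).toMvPolynomial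
    have hqe : ∀ y, MvPolynomial.eval y q = h p (ψ y) :=
      AffineMap.eval_toMvPolynomial ((h p).comp ψ)
    have hL : IsLocalization.Away (q * g) L := by
      have h1 : IsLocalization.Away (∏ i ∈ insert p s, ((h i).comp ψ).toMvPolynomial) L :=
        inferInstance
      rwa [Finset.prod_insert hp] at h1
    by_cases h0 : ∀ j, ((h p).comp ψ).linear (Pi.single j 1) = 0
    · have hq : q = MvPolynomial.C (((h p).comp ψ) 0) := by
        change affinePoly _ _ = _
        simp only [affinePoly, h0, map_zero, zero_mul, Finset.sum_const_zero, zero_add]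
      have hc : ∀ y, h p (ψ y) = ((h p).comp ψ) 0 := fun y => by
        rw [← hqe, hq, MvPolynomial.eval_C]
      by_cases hb : ((h p).comp ψ) 0 = 0
      · have : Subsingleton L := by
          have hu : IsUnit (algebraMap (MvPolynomial (Fin m) K) L (q * g)) :=
            IsLocalization.Away.algebraMap_isUnit _
          rw [hq, hb, map_zero, zero_mul, map_zero, isUnit_zero_iff] at hu
          exact subsingleton_of_zero_eq_one hu
        refine ⟨0, opLength_of_subsingleton _, ?_⟩
        rw [whitneySum_insert_of_subset hp]
        · rfl
        · rw [coe_affineZeros]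
          rintro _ ⟨y, rfl⟩
          exact (hc y).trans hb
      · have hLg : IsLocalization.Away g L := by
          refine IsLocalization.Away.of_associated (r := q * g) ?_
          have hqu : IsUnit q := by
            rw [hq]; exact (isUnit_iff_ne_zero.2 hb).map MvPolynomial.C
          rw [mul_comm]
          exact (associated_mul_unit_left _ _ hqu)
        obtain ⟨ℓ, h1, h2⟩ := ih m ψ L d hd
        refine ⟨ℓ, h1, ?_⟩
        rw [h2, whitneySum_insert_of_disjoint hp dimSign_empty]
        rw [coe_affineZeros]
        refine Set.eq_empty_of_forall_notMem ?_
        rintro _ ⟨⟨y, rfl⟩, hy⟩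
        exact hb ((hc y).symm.trans hy)
    · push Not at h0
      obtain ⟨i, hi⟩ := h0
      obtain ⟨m, rfl⟩ : ∃ k, m = k + 1 := ⟨m - 1, (Nat.succ_pred_eq_of_pos (Fin.pos i)).symm⟩
      set a := fun j => ((h p).comp ψ).linear (Pi.single j 1) with ha
      set b := ((h p).comp ψ) 0 with hb
      have hqab : q = affinePoly a b := rfl
      have hres : restrictHyp i a b g =
          ∏ j ∈ s, ((h j).comp (ψ.comp (hypParam i a b))).toMvPolynomial := by
        rw [hg, map_prod]
        refine Finset.prod_congr rfl fun j _ => MvPolynomial.funext fun y => ?_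
        rw [eval_restrictHyp, AffineMap.eval_toMvPolynomial, AffineMap.eval_toMvPolynomial]
        rfl
      have hloc : IsLocalization.Away
          (∏ j ∈ s, ((h j).comp (ψ.comp (hypParam i a b))).toMvPolynomial)
          (Localization.Away (restrictHyp i a b g)) := by
        rw [← hres]; infer_instance
      obtain ⟨d₁, hd₁⟩ := exists_derivations_extending (K := K) (Localization.Away g) g
      obtain ⟨d₂, hd₂⟩ := exists_derivations_extending (K := K)
        (Localization.Away (restrictHyp i a b g)) (restrictHyp i a b g)
      obtain ⟨ℓ₁, h1, h1'⟩ := ih (m + 1) ψ (Localization.Away g) d₁ hd₁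
      obtain ⟨ℓ₂, h2, h2'⟩ := ih m (ψ.comp (hypParam i a b))
        (Localization.Away (restrictHyp i a b g)) d₂ hd₂
      have hLab : IsLocalization.Away (affinePoly a b * g) L := hL
      have hdr := opLength_deletion_restriction (i := i) (a := a) hi b g d d₁ d₂ hd hd₁ hd₂
      refine ⟨ℓ₁ + ℓ₂, by rw [hdr, h1, h2]; rfl, ?_⟩
      have hrange : Set.range (ψ.comp (hypParam i a b)) =
          Set.range ψ ∩ (affineZeros (h p) : Set V) := by
        rw [coe_affineZeros, AffineMap.coe_comp, Set.range_comp, range_hypParam b hi]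
        ext v
        constructor
        · rintro ⟨y, hy, rfl⟩
          refine ⟨⟨y, rfl⟩, ?_⟩
          rw [Set.mem_ofPred_eq, ← hqe, hqab, eval_affinePoly]
          exact hy
        · rintro ⟨⟨y, rfl⟩, hy⟩
          refine ⟨y, ?_, rfl⟩
          rw [Set.mem_ofPred_eq, ← hqe, hqab, eval_affinePoly] at hy
          exact hy
      have hQ : ((((⊤ : AffineSubspace K (Fin (m + 1) → K)).map ψ : AffineSubspace K V)) : Set V) =
          Set.range ψ := by
        rw [AffineSubspace.coe_map, AffineSubspace.top_coe, Set.image_univ]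
      obtain ⟨y, hy⟩ : ∃ y, h p (ψ y) ≠ 0 := by
        by_contra hcon
        push Not at hcon
        have hq0 : q = 0 := MvPolynomial.funext fun y => by rw [hqe, hcon, map_zero]
        have := pderiv_affinePoly a b i
        rw [← hqab, hq0, map_zero] at this
        exact hi (MvPolynomial.C_eq_zero.1 this.symm)
      have hx : h p (ψ (hypParam i a b 0)) = 0 := by
        rw [← hqe, hqab, ← eval_restrictHyp, restrictHyp_affinePoly b hi, map_zero]
      have hfin := finrank_vectorSpan_inter_affineZeros
        (Q := (⊤ : AffineSubspace K (Fin (m + 1) → K)).map ψ) (h := h p)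
        (x := ψ (hypParam i a b 0)) (y := ψ y)
        (by rw [← SetLike.mem_coe, hQ]; exact ⟨_, rfl⟩) hx
        (by rw [← SetLike.mem_coe, hQ]; exact ⟨_, rfl⟩) hy
      rw [hQ] at hfin
      have key := whitneySum_insert_of_finrank (w := dimSign K) (X := Set.range ψ)
        (Z := fun i => (affineZeros (h i) : Set V)) hp hfin
      rw [key, Nat.cast_add, h1', h2', hrange]

end Induction

section Mobius

open scoped Classical

variable {V : Type*} {ι : Type*} (Z : ι → Set V) (s : Finset ι)

/-- The signed count of subfamilies with a given intersection. -/
noncomputable def whitneyMu (Y : Set V) : ℤ :=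
  ∑ S ∈ s.powerset, if Set.univ ∩ ⋂ i ∈ S, Z i = Y then (-1) ^ S.card else 0

variable {Z s} {P : Finset (Set V)}

theorem sum_whitneyMu_mul
    (hP : ∀ Y, Y ∈ P ↔ Y ≠ ∅ ∧ ∃ S ⊆ s, Set.univ ∩ ⋂ i ∈ S, Z i = Y)
    {w : Set V → ℤ} (hw : w ∅ = 0) :
    ∑ Y ∈ P, whitneyMu Z s Y * w Y =
      ∑ S ∈ s.powerset, (-1) ^ S.card * w (Set.univ ∩ ⋂ i ∈ S, Z i) := by
  simp only [whitneyMu, Finset.sum_mul, ite_mul, zero_mul]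
  rw [Finset.sum_comm]
  refine Finset.sum_congr rfl fun S hS => ?_
  rw [Finset.sum_ite_eq]
  split_ifs with h
  · rfl
  · have h0 : Set.univ ∩ ⋂ i ∈ S, Z i = ∅ := by
      by_contra hne
      exact h ((hP _).2 ⟨hne, S, Finset.mem_powerset.1 hS, rfl⟩)
    rw [h0, hw, mul_zero]

theorem sum_whitneyMu_eq_zero
    (hP : ∀ Y, Y ∈ P ↔ Y ≠ ∅ ∧ ∃ S ⊆ s, Set.univ ∩ ⋂ i ∈ S, Z i = Y)
    {Y : Set V} (hY : Y ∈ P) (hYu : Y ≠ Set.univ) :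
    ∑ X ∈ P.filter fun X => Y ⊆ X, whitneyMu Z s X = 0 := by
  obtain ⟨hYne, S₀, hS₀, hS₀Y⟩ := (hP Y).1 hY
  have h1 := sum_whitneyMu_mul hP (w := fun X => if Y ⊆ X then 1 else 0)
    (if_neg fun h => hYne (Set.subset_empty_iff.1 h))
  rw [Finset.sum_filter]
  simp only [mul_ite, mul_one, mul_zero] at h1
  rw [h1, ← Finset.sum_filter]
  have h2 : (s.powerset.filter fun S => Y ⊆ Set.univ ∩ ⋂ i ∈ S, Z i) =
      (s.filter fun i => Y ⊆ Z i).powerset := by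
    ext S
    simp only [Finset.mem_filter, Finset.mem_powerset, Set.univ_inter, Set.subset_iInter_iff,
      Finset.subset_iff]
    exact ⟨fun h i hi => ⟨h.1 hi, h.2 i hi⟩, fun h => ⟨fun i hi => (h hi).1, fun i hi => (h hi).2⟩⟩
  rw [h2]
  refine Finset.sum_powerset_neg_one_pow_card_of_nonempty ?_
  have : S₀.Nonempty := by
    rw [Finset.nonempty_iff_ne_empty]
    rintro rfl
    exact hYu (by simpa using hS₀Y.symm)
  obtain ⟨i, hi⟩ := this
  refine ⟨i, Finset.mem_filter.2 ⟨hS₀ hi, ?_⟩⟩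
  rw [← hS₀Y, Set.univ_inter]
  exact Set.biInter_subset_of_mem hi

theorem whitneyMu_univ (hZ : ∀ i ∈ s, Z i ≠ Set.univ) : whitneyMu Z s Set.univ = 1 := by
  rw [whitneyMu, Finset.sum_eq_single ∅]
  · simp
  · intro S hS hne
    obtain ⟨i, hi⟩ := Finset.nonempty_iff_ne_empty.2 hne
    refine if_neg fun h => hZ i (Finset.mem_powerset.1 hS hi) (Set.eq_univ_of_univ_subset ?_)
    rw [← h, Set.univ_inter]
    exact Set.biInter_subset_of_mem hi
  · intro h
    exact absurd (Finset.empty_mem_powerset s) h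

/-- The signed count of subfamilies is the only solution of the Möbius recursion. -/
theorem eq_whitneyMu
    (hP : ∀ Y, Y ∈ P ↔ Y ≠ ∅ ∧ ∃ S ⊆ s, Set.univ ∩ ⋂ i ∈ S, Z i = Y)
    (hZ : ∀ i ∈ s, Z i ≠ Set.univ) {μ : Set V → ℤ} (h1 : μ Set.univ = 1)
    (h2 : ∀ Y ∈ P, Y ≠ Set.univ → ∑ X ∈ P.filter fun X => Y ⊆ X, μ X = 0)
    (Y : Set V) (hY : Y ∈ P) : μ Y = whitneyMu Z s Y := by
  induction hk : (P.filter fun X => Y ⊆ X).card using Nat.strong_induction_on generalizing Y with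
  | _ k ih =>
  by_cases hYu : Y = Set.univ
  · rw [hYu, h1, whitneyMu_univ hZ]
  have hYm : Y ∈ P.filter fun X => Y ⊆ X := Finset.mem_filter.2 ⟨hY, le_rfl⟩
  have e := (h2 Y hY hYu).trans (sum_whitneyMu_eq_zero hP hY hYu).symm
  rw [← Finset.add_sum_erase _ _ hYm, ← Finset.add_sum_erase _ _ hYm] at e
  rw [Finset.sum_congr rfl fun X hX => ?_] at e
  · exact add_right_cancel e
  · have hX1 := Finset.mem_erase.1 hX
    have hX2 := Finset.mem_filter.1 hX1.2
    refine ih _ ?_ X hX2.1 rfl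
    rw [← hk]
    refine Finset.card_lt_card (Finset.ssubset_iff_of_subset (fun W hW => ?_) |>.2
      ⟨Y, hYm, fun hW => ?_⟩)
    · have := Finset.mem_filter.1 hW
      exact Finset.mem_filter.2 ⟨this.1, hX2.2.trans this.2⟩
    · exact hX1.1 ((Finset.mem_filter.1 hW).2.antisymm hX2.2)

end Mobius

section Mobius

open scoped Classical

variable {K : Type*} [Field K] {V : Type*} [AddCommGroup V] [Module K V]
  {ι : Type*} {Z : ι → Set V} {s : Finset ι} {P : Finset (Set V)}

theorem whitneySum_univ_eq (hP : ∀ Y, Y ∈ P ↔ Y ≠ ∅ ∧ ∃ S ⊆ s, Set.univ ∩ ⋂ i ∈ S, Z i = Y)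
    {w : Set V → ℤ} (hw : w ∅ = 0) :
    whitneySum K Z s w Set.univ =
      ∑ Y ∈ P, whitneyMu Z s Y * ((-1) ^ Module.finrank K (vectorSpan K (Set.univ : Set V)) * w Y) := by
  rw [sum_whitneyMu_mul hP (w := fun Y =>
    (-1) ^ Module.finrank K (vectorSpan K (Set.univ : Set V)) * w Y) (by rw [hw, mul_zero]),
    whitneySum]
  exact Finset.sum_congr rfl fun S _ => by rw [pow_add, mul_assoc]

theorem neg_one_pow_codim [FiniteDimensional K V] (Y : Set V) :
    (-1 : ℤ) ^ Module.finrank K (vectorSpan K (Set.univ : Set V)) *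
        (-1) ^ Module.finrank K (vectorSpan K Y) =
      (-1) ^ (Module.finrank K (vectorSpan K (Set.univ : Set V)) -
        Module.finrank K (vectorSpan K Y)) := by
  have h : Module.finrank K (vectorSpan K Y) ≤
      Module.finrank K (vectorSpan K (Set.univ : Set V)) :=
    Submodule.finrank_mono (vectorSpan_mono K (Set.subset_univ Y))
  obtain ⟨k, hk⟩ := Nat.exists_eq_add_of_le h
  rw [hk, Nat.add_sub_cancel_left, pow_add, mul_right_comm, ← mul_pow]
  simp

theorem abs_whitneyMu [FiniteDimensional K V] (h : ι → V →ᵃ[K] K)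
    (hP : ∀ Y, Y ∈ P ↔ Y ≠ ∅ ∧ ∃ S ⊆ s,
      Set.univ ∩ ⋂ i ∈ S, (affineZeros (h i) : Set V) = Y)
    {Y : Set V} (hY : Y ∈ P) :
    |whitneyMu (fun i => (affineZeros (h i) : Set V)) s Y| =
      whitneyMu (fun i => (affineZeros (h i) : Set V)) s Y *
        (-1) ^ (Module.finrank K (vectorSpan K (Set.univ : Set V)) -
          Module.finrank K (vectorSpan K Y)) := by
  let w : Set V → ℤ := fun X => if X = Y then (-1) ^ Module.finrank K (vectorSpan K Y) else 0
  have hw : w ∅ = 0 := if_neg fun h => ((hP Y).1 hY).1 h.symm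
  have h0 := whitneySum_nonneg h hw (fun X => by
    by_cases hX : X = Y
    · rw [show w X = _ from if_pos hX, hX, ← mul_pow]
      simp
    · simp [w, hX]) s ⊤
  rw [AffineSubspace.top_coe, whitneySum_univ_eq hP hw, Finset.sum_eq_single Y
    (fun X _ hX => by simp [w, hX]) (fun hY' => absurd hY hY')] at h0
  simp only [w, if_true, neg_one_pow_codim] at h0
  rw [← abs_of_nonneg h0, abs_mul, abs_pow]
  simp

end Mobius

section Length

variable {K : Type} [Field K] {n : ℕ}

theorem adjoin_range_wX_wD : Algebra.adjoin K (Set.range (Sum.elim (wX K n) (wD K n))) = ⊤ := by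
  have h : Sum.elim (wX K n) (wD K n) =
      RingQuot.mkAlgHom K (WeylRel K n) ∘ FreeAlgebra.ι K := by
    funext i
    rcases i with i | i <;> rfl
  rw [h, Set.range_comp, ← AlgHom.map_adjoin, FreeAlgebra.adjoin_range_ι, Algebra.map_top,
    AlgHom.range_eq_top]
  exact RingQuot.mkAlgHom_surjective K _

theorem opLength_eq_one_add_mlength_H1 [CharZero K] {f : MvPolynomial (Fin n) K} (hf : f ≠ 0)
    [Module (Weyl K n) (Localization.Away f)] [IsScalarTower K (Weyl K n) (Localization.Away f)]
    {d : Fin n → Derivation K (Localization.Away f) (Localization.Away f)}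
    (hx : ∀ (i : Fin n) (m : Localization.Away f), wX K n i • m =
      algebraMap (MvPolynomial (Fin n) K) (Localization.Away f) (MvPolynomial.X i) * m)
    (hD : ∀ i m, wD K n i • m = d i m)
    (hd : ∀ i r, d i (algebraMap (MvPolynomial (Fin n) K) (Localization.Away f) r) =
      algebraMap _ _ (pderiv i r)) :
    opLength (weylOps d) = 1 + mlength (Weyl K n) (H1 K n f) := by
  have hT : ∀ i m, weylOps d i m = Sum.elim (wX K n) (wD K n) i • m := by
    rintro (i | i) m
    exacts [(hx i m).symm, (hD i m).symm]
  have hK : ∀ (r : K) (m : Localization.Away f), algebraMap K (Weyl K n) r • m = r • m :=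
    fun r m => algebraMap_smul _ r m
  let φ : MvPolynomial (Fin n) K →ₗ[K] Localization.Away f :=
    (IsScalarTower.toAlgHom K (MvPolynomial (Fin n) K) (Localization.Away f)).toLinearMap
  have hφ : ∀ i x, φ (weylOps (L := MvPolynomial (Fin n) K) (fun i => pderiv i) i x) =
      weylOps d i (φ x) := by
    rintro (i | i) x
    · exact map_mul (algebraMap (MvPolynomial (Fin n) K) (Localization.Away f)) _ _
    · exact (hd i x).symm
  let N : Submodule (Weyl K n) (Localization.Away f) := Submodule.span (Weyl K n)
    (Set.range (algebraMap (MvPolynomial (Fin n) K) (Localization.Away f)))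
  have hN : ∀ y, y ∈ N ↔ y ∈ Set.range φ := fun y => by
    refine ⟨fun hy => ?_, fun hy => Submodule.subset_span hy⟩
    let N' := (submoduleOrderIsoStable hK _ adjoin_range_wX_wD (weylOps d) hT).symm
      ⟨LinearMap.range φ, by rintro i _ ⟨x, rfl⟩; exact ⟨_, hφ i x⟩⟩
    have : N ≤ N' := Submodule.span_le.2 fun z hz => hz
    exact this hy
  let T : Fin n ⊕ Fin n → Module.End K (H1 K n f) := fun i =>
    Algebra.lsmul K K (H1 K n f) (Sum.elim (wX K n) (wD K n) i)
  have h1 : mlength (Weyl K n) (H1 K n f) = opLength T :=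
    krullDim_submodule_eq_opLength (fun r m => algebraMap_smul _ r m) _ adjoin_range_wX_wD T
      fun _ _ => rfl
  rw [h1, opLength_eq_add φ (N.mkQ.restrictScalars K) hφ (T'' := T),
    opLength_weylOps_of_bijective _ (fun _ _ => rfl) Function.bijective_id]
  · intro i x
    rw [hT]
    exact N.mkQ.map_smul _ x
  · exact IsLocalization.injective _ (powers_le_nonZeroDivisors_of_noZeroDivisors hf)
  · exact N.mkQ_surjective
  · intro y
    exact (Submodule.Quotient.mk_eq_zero N).trans (hN y)

theorem eq_affinePoly_of_totalDegree_le_one {p : MvPolynomial (Fin n) K}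
    (hp : p.totalDegree ≤ 1) :
    p = affinePoly (fun j => MvPolynomial.coeff (Finsupp.single j 1) p)
      (MvPolynomial.coeff 0 p) := by
  ext e
  simp only [affinePoly, MvPolynomial.coeff_add, MvPolynomial.coeff_sum, MvPolynomial.coeff_C_mul,
    MvPolynomial.coeff_X, MvPolynomial.coeff_C, mul_ite, mul_one, mul_zero]
  by_cases h0 : e = 0
  · subst h0
    simp
  rw [if_neg (Ne.symm h0), add_zero]
  by_cases h1 : ∃ j, e = Finsupp.single j 1
  · obtain ⟨j, rfl⟩ := h1
    simp [Finsupp.single_left_inj]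
  · push Not at h1
    rw [Finset.sum_eq_zero fun j _ => if_neg (h1 j).symm]
    refine MvPolynomial.coeff_eq_zero_of_totalDegree_lt (hp.trans_lt ?_)
    by_contra hlt
    change ¬ 1 < e.degree at hlt
    obtain ⟨j, hj⟩ := Finsupp.ne_iff.1 h0
    have h2 : Finsupp.single j 1 + (e - Finsupp.single j 1) = e :=
      add_tsub_cancel_of_le (Finsupp.single_le_iff.2 (Nat.one_le_iff_ne_zero.2 hj))
    have h3 := congrArg Finsupp.degree h2
    rw [map_add, Finsupp.degree_single] at h3
    have h4 := (Finsupp.degree_eq_zero_iff (e - Finsupp.single j 1)).1 (by omega)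
    rw [h4, add_zero] at h2
    exact h1 j h2.symm

theorem exists_natCast_of_one_add_eq {x : WithBot ℕ∞} {ℓ : ℕ} (h : 1 + x = ℓ) :
    ∃ k : ℕ, x = k ∧ ℓ = k + 1 := by
  induction x with
  | bot => simp at h
  | coe x =>
    have h' : (1 : ℕ∞) + x = ℓ := WithBot.coe_injective h
    induction x with
    | top => simp at h'
    | coe k => exact ⟨k, rfl, by rw [add_comm]; exact_mod_cast h'.symm⟩

end Length

open scoped Classical in
theorem mem_interPoset_image {K : Type} {n : ℕ} {ι : Type*} {A : Finset ι} {Z Z' : ι → Set (Fin n → K)}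
    (h : ∀ p ∈ A, Z p = Z' p) (Y : Set (Fin n → K)) :
    Y ∈ interPoset K n Set.univ (A.image Z) ↔
      Y ≠ ∅ ∧ ∃ S ⊆ A, Set.univ ∩ ⋂ p ∈ S, Z' p = Y := by
  have h1 : ∀ S ⊆ A, ⋂ p ∈ S, Z p = ⋂ p ∈ S, Z' p := fun S hS =>
    Set.iInter₂_congr fun p hp => h p (hS hp)
  rw [interPoset, Finset.mem_filter, Finset.mem_image, and_comm]
  refine and_congr_right fun _ => ⟨?_, ?_⟩
  · rintro ⟨T, hT, rfl⟩
    obtain ⟨S, hS, rfl⟩ := Finset.subset_image_iff.1 (Finset.mem_powerset.1 hT)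
    exact ⟨S, hS, by rw [Finset.set_biInter_finset_image, h1 S hS]⟩
  · rintro ⟨S, hS, rfl⟩
    exact ⟨S.image Z, Finset.mem_powerset.2 (Finset.image_subset_image hS),
      by rw [Finset.set_biInter_finset_image, h1 S hS]⟩

open scoped Classical in
/-- For a hyperplane arrangement `𝒜` in `K^n` defined by a
squarefree product `f` of degree-one polynomials, the length of `H¹_{(f)}(R)`
as a left `D_n`-module equals `π(𝒜,1) − 1`, which also equals
`∑_{X ∈ L(𝒜), X ≠ V} |μ(X)|`. -/
theorem length_H1_eq_poincare_sub_one
    (K : Type) [Field K] [CharZero K] (n : ℕ)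
    (A : Finset (MvPolynomial (Fin n) K)) (f : MvPolynomial (Fin n) K)
    (hf : f = ∏ p ∈ A, p) (hsf : Squarefree f)
    (hdeg : ∀ p ∈ A, p.totalDegree = 1)
    [Module (Weyl K n) (Localization.Away f)]
    [IsScalarTower K (Weyl K n) (Localization.Away f)]
    (hnat : NatActs K n f)
    (𝒜 : Finset (Set (Fin n → K))) (h𝒜 : 𝒜 = A.image (zeroSet K n))
    (μ : Set (Fin n → K) → ℤ) (hμ : IsMobius K n Set.univ 𝒜 μ) :
    ∃ ℓ : ℕ, mlength (Weyl K n) (H1 K n f) = ℓ ∧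
      (ℓ : ℤ) = (poin K n Set.univ 𝒜 μ).eval 1 - 1 ∧
      (ℓ : ℤ) = ∑ X ∈ (interPoset K n Set.univ 𝒜).filter
          (fun X => X ≠ Set.univ), |μ X| := by
  have hpe : ∀ p ∈ A, ∀ x, MvPolynomial.eval x p = affineFunc
      (fun j => MvPolynomial.coeff (Finsupp.single j 1) p) (MvPolynomial.coeff 0 p) x := by
    intro p hp x
    conv_lhs => rw [eq_affinePoly_of_totalDegree_le_one (hdeg p hp).le]
    rw [eval_affinePoly, affineFunc_apply]
  set h : MvPolynomial (Fin n) K → (Fin n → K) →ᵃ[K] K := fun p => affineFunc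
    (fun j => MvPolynomial.coeff (Finsupp.single j 1) p) (MvPolynomial.coeff 0 p)
  have hZ : ∀ p ∈ A, zeroSet K n p = (affineZeros (h p) : Set (Fin n → K)) := by
    intro p hp
    rw [coe_affineZeros]
    ext x
    change MvPolynomial.eval x p = 0 ↔ h p x = 0
    rw [hpe p hp]
  have hZu : ∀ p ∈ A, (affineZeros (h p) : Set (Fin n → K)) ≠ Set.univ := by
    intro p hp hu
    have hp0 : p = 0 := MvPolynomial.funext fun x => by
      rw [map_zero]
      have hx : x ∈ zeroSet K n p := by rw [hZ p hp, hu]; trivial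
      exact hx
    have := hdeg p hp
    rw [hp0, MvPolynomial.totalDegree_zero] at this
    exact zero_ne_one this
  have hP : ∀ Y, Y ∈ interPoset K n Set.univ 𝒜 ↔
      Y ≠ ∅ ∧ ∃ S ⊆ A, Set.univ ∩ ⋂ p ∈ S, (affineZeros (h p) : Set (Fin n → K)) = Y := by
    rw [h𝒜]
    exact mem_interPoset_image hZ
  have hμν := eq_whitneyMu hP hZu hμ.1 hμ.2
  have huniv : Set.univ ∈ interPoset K n Set.univ 𝒜 :=
    (hP _).2 ⟨Set.univ_nonempty.ne_empty, ∅, Finset.empty_subset _, by simp⟩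
  -- the value of the Poincaré polynomial at `1`
  have hpoin : (poin K n Set.univ 𝒜 μ).eval 1 =
      ∑ Y ∈ interPoset K n Set.univ 𝒜, μ Y * (-1) ^ codim K n Set.univ Y := by
    simp [poin, Polynomial.eval_finsetSum]
  have habs : ∀ Y ∈ interPoset K n Set.univ 𝒜,
      |μ Y| = μ Y * (-1) ^ codim K n Set.univ Y := by
    intro Y hY
    rw [hμν Y hY, abs_whitneyMu h hP hY]
    rfl
  have hsum : (poin K n Set.univ 𝒜 μ).eval 1 - 1 =
      ∑ X ∈ (interPoset K n Set.univ 𝒜).filter (fun X => X ≠ Set.univ), |μ X| := by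
    rw [hpoin, ← Finset.sum_congr rfl habs, ← Finset.add_sum_erase _ _ huniv, hμ.1, abs_one,
      add_sub_cancel_left, Finset.filter_ne']
  have hwhit : whitneySum K (fun p => (affineZeros (h p) : Set (Fin n → K))) A (dimSign K)
      Set.univ = (poin K n Set.univ 𝒜 μ).eval 1 := by
    rw [whitneySum_univ_eq hP dimSign_empty, hpoin]
    refine Finset.sum_congr rfl fun Y hY => ?_
    rw [hμν Y hY, dimSign, if_pos (Set.nonempty_iff_ne_empty.2 ((hP Y).1 hY).1),
      neg_one_pow_codim]
    rfl
  -- the length of the localization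
  have hf2 : f = ∏ p ∈ A, ((h p).comp (AffineMap.id K (Fin n → K))).toMvPolynomial := by
    rw [hf]
    refine Finset.prod_congr rfl fun p hp => MvPolynomial.funext fun x => ?_
    rw [AffineMap.eval_toMvPolynomial, hpe p hp]
    rfl
  have hloc : IsLocalization.Away
      (∏ p ∈ A, ((h p).comp (AffineMap.id K (Fin n → K))).toMvPolynomial)
      (Localization.Away f) := by
    rw [← hf2]
    infer_instance
  obtain ⟨hx, hD⟩ := hnat
  choose d hDd hd using hD
  obtain ⟨ℓ, h1, h2⟩ := opLength_eq_whitneySum h A n (AffineMap.id K (Fin n → K))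
    (Localization.Away f) d hd
  rw [opLength_eq_one_add_mlength_H1 hsf.ne_zero hx hDd hd] at h1
  obtain ⟨k, hk, rfl⟩ := exists_natCast_of_one_add_eq h1
  have hkp : (k : ℤ) = (poin K n Set.univ 𝒜 μ).eval 1 - 1 := by
    rw [← hwhit, ← Set.range_id]
    exact eq_sub_of_add_eq (by rw [← Nat.cast_succ]; exact h2)
  exact ⟨k, hk, hkp, hkp.trans hsum⟩
end
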